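/- arXiv:math/0409551 — 5 statements merged into one kernel-verified Lean document; each statement's English description precedes it below -/
import Mathlib

section
/- A right R-module M is RD-flat if and only if M is a direct limit of finite direct sums of cyclically presented right R-modules (modules of the form R/rR with r ∈ R). -/
universe u

open MulOpposite

section RDDefs

variable (R : Type u) [Ring R]

/-- `IsTensorZero R M N l` encodes the statement `∑ mᵢ ⊗ nᵢ = 0` in the tensor product
`M ⊗_R N` of the right `R`-module `M` with the left `R`-module `N`, via the universal
property of the tensor product: every `R`-balanced biadditive map kills the sum. -/
def IsTensorZero (M N : Type u) [AddCommGroup M] [Module Rᵐᵒᵖ M]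
    [AddCommGroup N] [Module R N] (l : List (M × N)) : Prop :=
  ∀ (A : Type u) [AddCommGroup A], ∀ b : M → N → A,
    (∀ m₁ m₂ n, b (m₁ + m₂) n = b m₁ n + b m₂ n) →
    (∀ m n₁ n₂, b m (n₁ + n₂) = b m n₁ + b m n₂) →
    (∀ (r : R) (m : M) (n : N), b (op r • m) n = b m (r • n)) →
    (l.map fun p => b p.1 p.2).sum = 0

/-- A right `R`-module `M` is RD-flat if tensoring with `M` preserves exactness of all
RD-exact sequences of left `R`-modules; equivalently, for every injective linear map
`f : H → F` of left `R`-modules whose image is a relatively divisible submodule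
(`rF ∩ f(H) = r f(H)` for all `r`), the induced map `M ⊗ H → M ⊗ F` is injective. -/
def RDFlat (M : Type u) [AddCommGroup M] [Module Rᵐᵒᵖ M] : Prop :=
  ∀ (H F : Type u) [AddCommGroup H] [Module R H] [AddCommGroup F] [Module R F],
    ∀ f : H →ₗ[R] F, Function.Injective f →
    (∀ (r : R) (h : H) (y : F), f h = r • y → ∃ h' : H, h = r • h') →
    ∀ l : List (M × H),
      IsTensorZero R M F (l.map fun p => (p.1, f p.2)) → IsTensorZero R M H l

/-- A right `R`-module `N` is RD-injective if every homomorphism into `N` from a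
relatively divisible submodule of a right `R`-module extends to the whole module. -/
def RDInjective (N : Type u) [AddCommGroup N] [Module Rᵐᵒᵖ N] : Prop :=
  ∀ (K L : Type u) [AddCommGroup K] [Module Rᵐᵒᵖ K] [AddCommGroup L] [Module Rᵐᵒᵖ L],
    ∀ f : K →ₗ[Rᵐᵒᵖ] L, Function.Injective f →
    (∀ (r : R) (k : K) (y : L), f k = op r • y → ∃ k' : K, k = op r • k') →
    ∀ g : K →ₗ[Rᵐᵒᵖ] N, ∃ h : L →ₗ[Rᵐᵒᵖ] N, h.comp f = g

/-- An injective linear map `f : K → L` of right `R`-modules is pure if every finite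
system of linear equations `∑ⱼ xⱼ aᵢⱼ = kᵢ` with constants in `K` which is solvable
in `L` is solvable in `K`. -/
def IsPure {K L : Type u} [AddCommGroup K] [Module Rᵐᵒᵖ K] [AddCommGroup L]
    [Module Rᵐᵒᵖ L] (f : K →ₗ[Rᵐᵒᵖ] L) : Prop :=
  ∀ (m n : ℕ) (a : Fin m → Fin n → R) (k : Fin m → K),
    (∃ x : Fin n → L, ∀ i, (∑ j, op (a i j) • x j) = f (k i)) →
    ∃ y : Fin n → K, ∀ i, (∑ j, op (a i j) • y j) = k i

/-- A right `R`-module `M` is RD-coflat if every RD-exact sequence `0 → M → P → Q → 0`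
is pure-exact, i.e. whenever `M` embeds as a relatively divisible submodule of a right
module `P`, it is a pure submodule of `P`. -/
def RDCoflat (M : Type u) [AddCommGroup M] [Module Rᵐᵒᵖ M] : Prop :=
  ∀ (P : Type u) [AddCommGroup P] [Module Rᵐᵒᵖ P],
    ∀ f : M →ₗ[Rᵐᵒᵖ] P, Function.Injective f →
    (∀ (r : R) (x : M) (y : P), f x = op r • y → ∃ x' : M, x = op r • x') →
    IsPure R f

/-- A right `R`-module `N` is pure-injective if every homomorphism into `N` from a pure
submodule of a right `R`-module extends to the whole module. -/
def PureInjective (N : Type u) [AddCommGroup N] [Module Rᵐᵒᵖ N] : Prop :=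
  ∀ (K L : Type u) [AddCommGroup K] [Module Rᵐᵒᵖ K] [AddCommGroup L] [Module Rᵐᵒᵖ L],
    ∀ f : K →ₗ[Rᵐᵒᵖ] L, Function.Injective f → IsPure R f →
    ∀ g : K →ₗ[Rᵐᵒᵖ] N, ∃ h : L →ₗ[Rᵐᵒᵖ] N, h.comp f = g

/-- A right `R`-module `F` is pure-projective if every homomorphism from `F` to a
quotient in a pure-exact sequence lifts. -/
def PureProjective (F : Type u) [AddCommGroup F] [Module Rᵐᵒᵖ F] : Prop :=
  ∀ (L Q : Type u) [AddCommGroup L] [Module Rᵐᵒᵖ L] [AddCommGroup Q] [Module Rᵐᵒᵖ Q],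
    ∀ p : L →ₗ[Rᵐᵒᵖ] Q, Function.Surjective p → IsPure R (LinearMap.ker p).subtype →
    ∀ g : F →ₗ[Rᵐᵒᵖ] Q, ∃ h : F →ₗ[Rᵐᵒᵖ] L, p.comp h = g

/-- A right `R`-module `F` is RD-projective if every homomorphism from `F` to a
quotient in an RD-exact sequence (the kernel is a relatively divisible submodule)
lifts. -/
def RDProjective (F : Type u) [AddCommGroup F] [Module Rᵐᵒᵖ F] : Prop :=
  ∀ (L Q : Type u) [AddCommGroup L] [Module Rᵐᵒᵖ L] [AddCommGroup Q] [Module Rᵐᵒᵖ Q],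
    ∀ p : L →ₗ[Rᵐᵒᵖ] Q, Function.Surjective p →
    (∀ (r : R) (x : L), p x = 0 → (∃ y : L, x = op r • y) →
      ∃ z : L, p z = 0 ∧ x = op r • z) →
    ∀ g : F →ₗ[Rᵐᵒᵖ] Q, ∃ h : F →ₗ[Rᵐᵒᵖ] L, p.comp h = g

end RDDefs

/-- Equational criterion for RD-flatness. -/
def RDCrit (R : Type u) [Ring R] (M : Type u) [AddCommGroup M] [Module Rᵐᵒᵖ M] : Prop :=
  ∀ (T : Type) [Fintype T] (J : Type u) (x : T → M) (a : T → J →₀ R),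
    (∀ j, ∑ t, op (a t j) • x t = 0) →
    ∃ (p : ℕ) (y : Fin p → M) (r : Fin p → R) (B : Fin p → T → R) (C : Fin p → J →₀ R),
      (∀ k, op (r k) • y k = 0) ∧ (∀ t, x t = ∑ k, op (B k t) • y k) ∧
      ∀ k, ∑ t, B k t • a t = r k • C k

section Tensor

variable {R : Type u} [Ring R] {M : Type u} [AddCommGroup M] [Module Rᵐᵒᵖ M]

/-- The action `m ↦ m · v` on finitely supported vectors. -/
noncomputable def rdAct {S : Type u} (m : M) (v : S →₀ R) : S →₀ M :=
  v.mapRange (fun a => op a • m) (by simp)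

@[simp] lemma rdAct_apply {S : Type u} (m : M) (v : S →₀ R) (s : S) :
    rdAct m v s = op (v s) • m := rfl

lemma rdAct_add_left {S : Type u} (m m' : M) (v : S →₀ R) :
    rdAct (m + m') v = rdAct m v + rdAct m' v := by ext s; simp

lemma rdAct_add_right {S : Type u} (m : M) (v v' : S →₀ R) :
    rdAct m (v + v') = rdAct m v + rdAct m v' := by ext s; simp [add_smul]

lemma rdAct_sub_right {S : Type u} (m : M) (v v' : S →₀ R) :
    rdAct m (v - v') = rdAct m v - rdAct m v' := by ext s; simp [sub_smul]

lemma rdAct_neg_left {S : Type u} (m : M) (v : S →₀ R) :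
    rdAct (-m) v = - rdAct m v := by ext s; simp

lemma rdAct_smul {S : Type u} (m : M) (r : R) (v : S →₀ R) :
    rdAct (op r • m) v = rdAct m (r • v) := by ext s; simp [mul_smul]

lemma list_map_sum_apply {α S : Type*} (L : List α) (g : α → S →₀ M) (s : S) :
    (L.map g).sum s = (L.map fun q => g q s).sum := by
  induction L with
  | nil => simp
  | cons a L ih => simp [ih]

/-- Vanishing in a tensor product with a presented left module. -/
lemma tensorZero_presented {S F : Type u} [AddCommGroup F] [Module R F]
    (π : (S →₀ R) →ₗ[R] F) (hπ : Function.Surjective π) (l : List (M × (S →₀ R)))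
    (h : IsTensorZero R M F (l.map fun p => (p.1, π p.2))) :
    ∃ L : List (M × (S →₀ R)), (∀ q ∈ L, π q.2 = 0) ∧
      (l.map fun p => rdAct p.1 p.2).sum = (L.map fun p => rdAct p.1 p.2).sum := by
  let U : AddSubgroup (S →₀ M) :=
    AddSubgroup.closure {X | ∃ (m : M) (v : S →₀ R), π v = 0 ∧ X = rdAct m v}
  have key : ∀ X ∈ U, ∃ L : List (M × (S →₀ R)), (∀ q ∈ L, π q.2 = 0) ∧
      X = (L.map fun p => rdAct p.1 p.2).sum := by
    intro X hX
    induction hX using AddSubgroup.closure_induction with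
    | mem X hX =>
      obtain ⟨m, v, hv, rfl⟩ := hX
      exact ⟨[(m, v)], by simpa using hv, by simp⟩
    | zero => exact ⟨[], by simp, by simp⟩
    | add X Y _ _ hX hY =>
      obtain ⟨L, hL, rfl⟩ := hX
      obtain ⟨L', hL', rfl⟩ := hY
      refine ⟨L ++ L', ?_, by simp⟩
      intro q hq
      rcases List.mem_append.1 hq with h | h
      · exact hL q h
      · exact hL' q h
    | neg X _ hX =>
      obtain ⟨L, hL, rfl⟩ := hX
      refine ⟨L.map fun q => (-q.1, q.2), ?_, ?_⟩
      · intro q hq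
        obtain ⟨q', hq', rfl⟩ := List.mem_map.1 hq
        exact hL q' hq'
      · rename_i hmem; clear hL hmem
        induction L with
        | nil => simp
        | cons a L ih => simp [rdAct_neg_left, add_comm] at ih ⊢; rw [ih]
  apply key
  let b : M → F → (S →₀ M) ⧸ U := fun m y =>
    QuotientAddGroup.mk (rdAct m (Function.surjInv hπ y))
  have hb : ∀ m v, b m (π v) = QuotientAddGroup.mk (rdAct m v) := by
    intro m v
    rw [QuotientAddGroup.eq]
    refine AddSubgroup.subset_closure ⟨m, v - Function.surjInv hπ (π v), ?_, ?_⟩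
    · simp [Function.surjInv_eq hπ]
    · rw [rdAct_sub_right]; abel
  have := h ((S →₀ M) ⧸ U) b ?_ ?_ ?_
  · rw [List.map_map] at this
    rw [← QuotientAddGroup.eq_zero_iff]
    rw [← this]
    clear this h
    induction l with
    | nil => simp
    | cons a l ih => 
      simp only [List.map_cons, List.sum_cons, QuotientAddGroup.mk_add, Function.comp_apply, hb]
      rw [ih]
  · intro m₁ m₂ n
    obtain ⟨v, rfl⟩ := hπ n
    simp only [hb, rdAct_add_left]; rfl
  · intro m n₁ n₂
    obtain ⟨v, rfl⟩ := hπ n₁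
    obtain ⟨w, rfl⟩ := hπ n₂
    rw [← map_add]
    simp only [hb, rdAct_add_right]; rfl
  · intro r m n
    obtain ⟨v, rfl⟩ := hπ n
    rw [← map_smul]
    simp only [hb, rdAct_smul]

lemma RDCrit.rdFlat (hM : RDCrit R M) : RDFlat R M := by
  intro H F _ _ _ _ f hf hrd l hl A _ b b1 b2 b3
  let π : ((Fin l.length ⊕ F) →₀ R) →ₗ[R] F :=
    Finsupp.linearCombination R (Sum.elim (fun i => f (l.get i).2) id)
  have hπ : Function.Surjective π := fun y => ⟨Finsupp.single (Sum.inr y) 1, by simp [π]⟩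
  obtain ⟨L, hL, hLs⟩ := tensorZero_presented (M := M) π hπ
    (List.ofFn fun i => ((l.get i).1, Finsupp.single (Sum.inl i) 1)) (by
      convert hl using 1
      rw [List.map_ofFn]
      conv_rhs => rw [← List.ofFn_get l, List.map_ofFn]
      congr 1
      ext i <;> simp [π])
  rw [List.map_ofFn, List.sum_ofFn] at hLs
  rw [← List.ofFn_get L, List.map_ofFn, List.sum_ofFn] at hLs
  let y : Fin L.length → M := fun t => (L.get t).1
  let ρ : Fin L.length → (Fin l.length ⊕ F) →₀ R := fun t => (L.get t).2
  have hρ : ∀ t, π (ρ t) = 0 := fun t => hL _ (List.get_mem _ _)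
  have hr : ∀ s : F, ∑ t, op (ρ t (Sum.inr s)) • y t = 0 := by
    intro s
    have := DFunLike.congr_fun hLs (Sum.inr s)
    simpa [Finsupp.finsetSum_apply, y, ρ] using this.symm
  have hx : ∀ i, (l.get i).1 = ∑ t, op (ρ t (Sum.inl i)) • y t := by
    intro i
    have := DFunLike.congr_fun hLs (Sum.inl i)
    simp only [Finsupp.finsetSum_apply, Function.comp, rdAct_apply] at this
    rw [Finset.sum_eq_single i] at this
    · simpa [y, ρ] using this
    · intro j _ hj
      simp [hj]
    · simp
  obtain ⟨p, y', r, B, C, hy', hyB, hBC⟩ := hM (Fin L.length) F y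
    (fun t => (ρ t).comapDomain Sum.inr Sum.inr_injective.injOn) (by simpa using hr)
  obtain ⟨v, v_def⟩ : ∃ v : Fin p → (Fin l.length ⊕ F) →₀ R, ∀ k, v k = ∑ t, B k t • ρ t :=
    ⟨_, fun _ => rfl⟩
  have hv : ∀ k, π (v k) = 0 := by
    intro k; simp [v_def, hρ]
  have hvr : ∀ k s, v k (Sum.inr s) = r k * C k s := by
    intro k s
    have := DFunLike.congr_fun (hBC k) s
    simpa [v_def, Finsupp.finsetSum_apply] using this
  have hsplit : ∀ k, v k = (∑ i, Finsupp.single (Sum.inl i) (v k (Sum.inl i))) +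
      Finsupp.mapDomain Sum.inr (r k • C k) := by
    intro k
    ext s
    rcases s with i | s
    · rw [Finsupp.add_apply, Finsupp.mapDomain_of_notMem_range _ _ (by simp), Finsupp.finsetSum_apply]
      rw [Finset.sum_eq_single i (fun j _ hj => by simp [hj]) (by simp)]
      simp
    · rw [Finsupp.add_apply, Finsupp.mapDomain_apply Sum.inr_injective, Finsupp.finsetSum_apply]
      simp [hvr]
  have hg : ∀ k, ∃ h' : H, ∑ i, v k (Sum.inl i) • (l.get i).2 = r k • h' := by
    intro k
    apply hrd (r k) _ (- Finsupp.linearCombination R id (C k))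
    have := hv k
    rw [hsplit k] at this
    simp only [π, map_add, map_sum, Finsupp.linearCombination_single, Sum.elim_inl,
      Finsupp.linearCombination_mapDomain] at this
    rw [smul_neg]
    apply eq_neg_of_add_eq_zero_left
    simpa [Function.comp_def, Function.id_def] using this
  choose h' hh' using hg
  have hx' : ∀ i, (l.get i).1 = ∑ k, op (v k (Sum.inl i)) • y' k := by
    intro i
    rw [hx]
    simp only [hyB, Finset.smul_sum, v_def, Finsupp.finsetSum_apply, Finsupp.smul_apply, Finset.op_sum,
      Finset.sum_smul, smul_smul, smul_eq_mul, op_mul]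
    rw [Finset.sum_comm]
  let b' : M →+ H →+ A := AddMonoidHom.mk' (fun m => AddMonoidHom.mk' (b m) (b2 m))
    (fun m m' => by ext n; exact b1 m m' n)
  have hb' : ∀ m n, b m n = b' m n := fun _ _ => rfl
  have b3' : ∀ (r : R) (m : M) (n : H), b' (op r • m) n = b' m (r • n) := b3
  rw [← List.ofFn_get l, List.map_ofFn, List.sum_ofFn]
  simp only [Function.comp, hb']
  have : ∀ i, b' (l.get i).1 (l.get i).2 = ∑ k, b' (y' k) (v k (Sum.inl i) • (l.get i).2) := by
    intro i
    conv_lhs => rw [hx' i]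
    simp [b3', AddMonoidHom.finsetSum_apply]
  simp only [this]
  rw [Finset.sum_comm]
  apply Finset.sum_eq_zero
  intro k _
  rw [← map_sum, hh', ← b3', hy']
  simp

end Tensor

section FlatToCrit

variable {R : Type u} [Ring R] {M : Type u} [AddCommGroup M] [Module Rᵐᵒᵖ M]

lemma RDFlat.rdCrit (hM : RDFlat R M) : RDCrit R M := by
  classical
  intro T _ J x a hxa
  let W : Type u := {w : R × (T → R) × (J →₀ R) // ∑ t, w.2.1 t • a t = w.1 • w.2.2}
  let inc : (T → R) →ₗ[R] ((T ⊕ W) →₀ R) :=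
    ∑ t, (Finsupp.lsingle (Sum.inl t)).comp (LinearMap.proj t)
  have inc_inl : ∀ v t, inc v (Sum.inl t) = v t := by
    intro v t
    simp only [inc, LinearMap.sum_apply, Finsupp.finsetSum_apply]
    rw [Finset.sum_eq_single t (fun j _ hj => by simp [hj]) (by simp)]
    simp
  have inc_inr : ∀ v w, inc v (Sum.inr w) = 0 := by
    intro v w
    simp [inc, LinearMap.sum_apply, Finsupp.finsetSum_apply]
  have inc_single : ∀ t, inc (Pi.single t 1) = Finsupp.single (Sum.inl t) 1 := by
    intro t
    ext s
    rcases s with s | s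
    · rw [inc_inl]
      simp [Finsupp.single_apply, Pi.single_apply, eq_comm]
    · rw [inc_inr]; simp
  let ρ : W → ((T ⊕ W) →₀ R) := fun w => inc w.1.2.1 - Finsupp.single (Sum.inr w) w.1.1
  let K : Submodule R ((T ⊕ W) →₀ R) := Submodule.span R (Set.range ρ)
  let AA : (T → R) →ₗ[R] (J →₀ R) := ∑ t, (LinearMap.toSpanSingleton R _ (a t)).comp (LinearMap.proj t)
  have AA_apply : ∀ v, AA v = ∑ t, v t • a t := by intro v; simp [AA]
  let ψ : (T → R) →ₗ[R] ((((T ⊕ W) →₀ R) ⧸ K) × (J →₀ R)) := (K.mkQ.comp inc).prod (-AA)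
  have ψ_apply : ∀ v, ψ v = (K.mkQ (inc v), - AA v) := fun v => rfl
  let Q := LinearMap.range ψ
  let f : (((T ⊕ W) →₀ R) ⧸ K) →ₗ[R] ((((T ⊕ W) →₀ R) ⧸ K) × (J →₀ R)) ⧸ Q :=
    Q.mkQ.comp (LinearMap.inl R _ _)
  have hw : ∀ (r : R) (v : T → R) (c : J →₀ R), AA v = r • c →
      ∃ g, K.mkQ (inc v) = r • g := by
    intro r v c h
    let w : W := ⟨(r, v, c), by rw [← AA_apply]; exact h⟩
    refine ⟨K.mkQ (Finsupp.single (Sum.inr w) 1), ?_⟩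
    rw [← map_smul, ← sub_eq_zero, ← map_sub]
    simp only [Submodule.mkQ_apply]
    rw [Submodule.Quotient.mk_eq_zero]
    have : ρ w ∈ K := Submodule.subset_span ⟨w, rfl⟩
    simpa [ρ, w] using this
  have hf : Function.Injective f := by
    rw [← LinearMap.ker_eq_bot, LinearMap.ker_eq_bot']
    intro h hh
    simp only [f, LinearMap.comp_apply, Submodule.mkQ_apply] at hh
    rw [Submodule.Quotient.mk_eq_zero] at hh
    obtain ⟨v, hv⟩ := hh
    have h1 := congrArg Prod.fst hv
    have h2 := congrArg Prod.snd hv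
    simp only [ψ_apply, LinearMap.inl_apply, neg_eq_zero] at h1 h2
    obtain ⟨g, hg⟩ := hw 0 v 0 (by simpa using h2)
    rw [← h1, hg, zero_smul]
  have hrd : ∀ (r : R) (h : (((T ⊕ W) →₀ R) ⧸ K)) (y : _), f h = r • y → ∃ h', h = r • h' := by
    intro r h y hy
    obtain ⟨⟨h', c⟩, rfl⟩ := Q.mkQ_surjective y
    simp only [f, LinearMap.comp_apply] at hy
    rw [← map_smul, ← sub_eq_zero, ← map_sub, Submodule.mkQ_apply,
      Submodule.Quotient.mk_eq_zero] at hy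
    obtain ⟨v, hv⟩ := hy
    have h1 := congrArg Prod.fst hv
    have h2 := congrArg Prod.snd hv
    simp only [ψ_apply, LinearMap.inl_apply, Prod.smul_mk, Prod.mk_sub_mk, zero_sub, neg_inj] at h1 h2
    obtain ⟨g, hg⟩ := hw r v c h2
    refine ⟨g + h', ?_⟩
    rw [smul_add, ← hg, h1, sub_add_cancel]
  have hz := hM _ _ f hf hrd
    (Finset.univ.toList.map fun t : T => (x t, K.mkQ (Finsupp.single (Sum.inl t) 1))) (by
      intro A _ b b1 b2 b3
      let b' : M →+ _ →+ A := AddMonoidHom.mk' (fun m => AddMonoidHom.mk' (b m) (b2 m))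
        (fun m m' => by ext n; exact b1 m m' n)
      have hb' : ∀ m n, b m n = b' m n := fun _ _ => rfl
      have b3' : ∀ (r : R) (m : M) n, b' (op r • m) n = b' m (r • n) := b3
      rw [List.map_map, List.map_map]
      simp only [Function.comp_def, hb']
      rw [Finset.sum_map_toList]
      have hfe : ∀ t, f (K.mkQ (Finsupp.single (Sum.inl t) 1)) =
          (a t).sum fun j c => c • Q.mkQ (0, Finsupp.single j 1) := by
        intro t
        have e1 : f (K.mkQ (Finsupp.single (Sum.inl t) 1)) = Q.mkQ (0, a t) := by
          rw [← sub_eq_zero]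
          simp only [f, LinearMap.comp_apply]
          rw [← map_sub, Submodule.mkQ_apply, Submodule.Quotient.mk_eq_zero]
          refine ⟨Pi.single t 1, ?_⟩
          simp only [ψ_apply, inc_single, AA_apply, LinearMap.inl_apply, Prod.mk_sub_mk, sub_zero, zero_sub]
          congr 2
          rw [Finset.sum_eq_single t (fun j _ hj => by simp [hj]) (by simp)]
          simp
        rw [e1]
        let θ : (J →₀ R) →ₗ[R] _ := Q.mkQ.comp (LinearMap.inr R _ _)
        change θ (a t) = (a t).sum fun j c => c • θ (Finsupp.single j 1)
        conv_lhs => rw [← Finsupp.sum_single (a t), map_finsuppSum]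
        congr 1
        ext j c
        rw [← map_smul]
        simp
      let s : Finset J := Finset.univ.biUnion fun t => (a t).support
      have hs : ∀ t, (a t).support ⊆ s := fun t =>
        Finset.subset_biUnion_of_mem (fun t => (a t).support) (Finset.mem_univ t)
      have : ∀ t, b' (x t) (f (K.mkQ (Finsupp.single (Sum.inl t) 1))) =
          ∑ j ∈ s, b' (op (a t j) • x t) (Q.mkQ (0, Finsupp.single j 1)) := by
        intro t
        rw [hfe, Finsupp.sum_of_support_subset _ (hs t) _ (by simp), map_sum]
        simp only [b3']
      simp only [this]
      rw [Finset.sum_comm]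
      apply Finset.sum_eq_zero
      intro j _
      rw [← AddMonoidHom.finsetSum_apply, ← map_sum, hxa]
      simp)
  obtain ⟨L, hL, hLs⟩ := tensorZero_presented K.mkQ K.mkQ_surjective
    (Finset.univ.toList.map fun t : T => (x t, Finsupp.single (Sum.inl t) 1)) (by
      rw [List.map_map]; exact hz)
  rw [List.map_map] at hLs
  simp only [Function.comp_def] at hLs
  rw [Finset.sum_map_toList] at hLs
  let Φ : (W →₀ M) →+ ((T ⊕ W) →₀ M) := Finsupp.liftAddHom fun w =>
    AddMonoidHom.mk' (fun m => rdAct m (ρ w)) (fun m m' => rdAct_add_left m m' _)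
  have hΦ : ∀ m v, v ∈ K → rdAct m v ∈ AddMonoidHom.range Φ := by
    intro m v hv
    induction hv using Submodule.span_induction generalizing m with
    | mem v hv =>
      obtain ⟨w, rfl⟩ := hv
      exact ⟨Finsupp.single w m, by
        simp only [Φ, Finsupp.liftAddHom_apply_single]; rfl⟩
    | zero => 
      convert zero_mem (AddMonoidHom.range Φ)
      ext; simp
    | add v v' _ _ h h' => rw [rdAct_add_right]; exact add_mem (h m) (h' m)
    | smul r v _ h => rw [← rdAct_smul]; exact h _
  have hmem : ∑ t, rdAct (x t) (Finsupp.single (Sum.inl t : T ⊕ W) (1 : R)) ∈ AddMonoidHom.range Φ := by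
    rw [hLs]
    apply list_sum_mem
    intro X hX
    obtain ⟨q, hq, rfl⟩ := List.mem_map.1 hX
    apply hΦ
    simpa using hL q hq
  obtain ⟨y, hy⟩ := hmem
  have hy' : ∀ s, ∑ w ∈ y.support, op (ρ w s) • y w =
      ∑ t, op (Finsupp.single (Sum.inl t : T ⊕ W) (1 : R) s) • x t := by
    intro s
    have := DFunLike.congr_fun hy s
    simpa [Φ, Finsupp.sum, Finsupp.finsetSum_apply] using this
  have hyr : ∀ w, op w.1.1 • y w = 0 := by
    intro w
    have := hy' (Sum.inr w)
    simp only [ρ, Finsupp.sub_apply, inc_inr] at this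
    rw [Finset.sum_eq_single w (fun j _ hj => by simp [hj])
      (fun h => by simp [Finsupp.notMem_support_iff.1 h])] at this
    simpa using this
  have hyl : ∀ t, x t = ∑ w ∈ y.support, op (w.1.2.1 t) • y w := by
    intro t
    have := hy' (Sum.inl t)
    simp only [ρ, Finsupp.sub_apply, inc_inl] at this
    rw [Finset.sum_eq_single (s := Finset.univ) t (fun j _ hj => by simp [hj]) (by simp)] at this
    simpa using this.symm
  let e := y.support.equivFin
  refine ⟨y.support.card, fun k => y (e.symm k), fun k => (e.symm k).1.1.1,
    fun k => (e.symm k).1.1.2.1, fun k => (e.symm k).1.1.2.2, fun k => hyr _, fun t => ?_,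
    fun k => (e.symm k).1.2⟩
  rw [hyl, ← Finset.sum_coe_sort]
  exact (Equiv.sum_comp e.symm (fun w : y.support => op (w.1.1.2.1 t) • y w.1)).symm

end FlatToCrit

section Cyc

variable {R : Type u} [Ring R] {M : Type u} [AddCommGroup M] [Module Rᵐᵒᵖ M]

/-- Finite direct sum of cyclically presented right modules. -/
abbrev CycSum (R : Type u) [Ring R] {n : ℕ} (r : Fin n → R) : Type u :=
  ∀ k : Fin n, R ⧸ (Submodule.span Rᵐᵒᵖ {r k} : Submodule Rᵐᵒᵖ R)

/-- The element with coordinates `a`. -/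
def cycMk {n : ℕ} (r : Fin n → R) (a : Fin n → R) : CycSum R r :=
  fun k => Submodule.Quotient.mk (a k)

/-- The generators. -/
def cycGen {n : ℕ} (r : Fin n → R) (k : Fin n) : CycSum R r :=
  Pi.single k (Submodule.Quotient.mk 1)

lemma mem_span_right (r a : R) : a ∈ (Submodule.span Rᵐᵒᵖ {r} : Submodule Rᵐᵒᵖ R) ↔
    ∃ c, a = r * c := by
  rw [Submodule.mem_span_singleton]
  constructor
  · rintro ⟨c, rfl⟩
    exact ⟨c.unop, rfl⟩
  · rintro ⟨c, rfl⟩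
    exact ⟨op c, rfl⟩

lemma cycMk_surj {n : ℕ} (r : Fin n → R) (z : CycSum R r) : ∃ a, cycMk r a = z := by
  choose a ha using fun k => Submodule.Quotient.mk_surjective _ (z k)
  exact ⟨a, funext ha⟩

lemma cycMk_eq_sum {n : ℕ} (r : Fin n → R) (a : Fin n → R) :
    cycMk r a = ∑ k, op (a k) • cycGen r k := by
  ext k
  rw [Finset.sum_apply, Finset.sum_eq_single k]
  · simp only [cycMk, cycGen, Pi.smul_apply, Pi.single_eq_same]
    rw [← Submodule.Quotient.mk_smul]
    simp
  · intro j _ hj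
    simp [cycGen, hj.symm]
  · simp

lemma cycMk_eq_zero {n : ℕ} (r : Fin n → R) (a : Fin n → R) :
    cycMk r a = 0 ↔ ∀ k, ∃ c, a k = r k * c := by
  rw [funext_iff]
  refine forall_congr' fun k => ?_
  rw [← mem_span_right, ← Submodule.Quotient.mk_eq_zero]
  rfl

lemma cycGen_rel {n : ℕ} (r : Fin n → R) (k : Fin n) : op (r k) • cycGen r k = 0 := by
  ext j
  by_cases h : j = k
  · subst h
    simp only [cycGen, Pi.smul_apply, Pi.single_eq_same]
    rw [← Submodule.Quotient.mk_smul, Pi.zero_apply, Submodule.Quotient.mk_eq_zero, mem_span_right]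
    exact ⟨1, by simp⟩
  · simp [cycGen, h]

lemma cyc_gen_sum {n : ℕ} (r : Fin n → R) (z : CycSum R r) :
    ∃ a : Fin n → R, z = ∑ k, op (a k) • cycGen r k := by
  obtain ⟨a, rfl⟩ := cycMk_surj r z
  exact ⟨a, cycMk_eq_sum r a⟩

/-- Map out of a finite direct sum of cyclically presented modules. -/
lemma exists_cycLift {n : ℕ} (r : Fin n → R) {N : Type u} [AddCommGroup N] [Module Rᵐᵒᵖ N]
    (y : Fin n → N) (hy : ∀ k, op (r k) • y k = 0) :
    ∃ g : CycSum R r →ₗ[Rᵐᵒᵖ] N, ∀ k, g (cycGen r k) = y k := by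
  let s : Fin n → R →ₗ[Rᵐᵒᵖ] N := fun k =>
    { toFun := fun a => op a • y k
      map_add' := by intro a b; simp [add_smul]
      map_smul' := by intro c a; simp [← smul_smul] }
  have hs : ∀ k, (Submodule.span Rᵐᵒᵖ {r k} : Submodule Rᵐᵒᵖ R) ≤ LinearMap.ker (s k) := by
    intro k
    rw [Submodule.span_le]
    rintro _ rfl
    exact hy k
  refine ⟨∑ k, (Submodule.liftQ _ (s k) (hs k)).comp (LinearMap.proj k), fun k => ?_⟩
  rw [LinearMap.sum_apply, Finset.sum_eq_single k]
  · simp only [cycGen, LinearMap.comp_apply, LinearMap.proj_apply, Pi.single_eq_same]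
    change op (1 : R) • y k = y k
    simp
  · intro j _ hj
    simp [cycGen, hj]
  · simp

lemma cyc_hom_ext {n : ℕ} (r : Fin n → R) {N : Type u} [AddCommGroup N] [Module Rᵐᵒᵖ N]
    {g h : CycSum R r →ₗ[Rᵐᵒᵖ] N} (H : ∀ k, g (cycGen r k) = h (cycGen r k)) : g = h := by
  refine LinearMap.ext fun z => ?_
  obtain ⟨a, rfl⟩ := cyc_gen_sum r z
  simp [H]

lemma cycSum_rdCrit {n : ℕ} (r : Fin n → R) {T : Type} [Fintype T] {J : Type u}
    (x : T → CycSum R r) (a : T → J →₀ R) (h : ∀ j, ∑ t, op (a t j) • x t = 0) :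
    ∃ (B : Fin n → T → R) (C : Fin n → J →₀ R),
      (∀ t, x t = ∑ k, op (B k t) • cycGen r k) ∧ ∀ k, ∑ t, B k t • a t = r k • C k := by
  classical
  choose B hB using fun t => cyc_gen_sum r (x t)
  have hc : ∀ k j, ∃ c, (∑ t, B t k • a t) j = r k * c := by
    intro k j
    revert k
    rw [← cycMk_eq_zero r, ← h j, cycMk_eq_sum]
    simp only [hB, Finset.smul_sum, smul_smul, Finsupp.finsetSum_apply, Finset.op_sum,
      Finsupp.smul_apply, smul_eq_mul, op_mul]
    rw [Finset.sum_comm]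
    have aux : ∀ (N : Type u) [AddCommGroup N] [Module Rᵐᵒᵖ N] (g : T → Rᵐᵒᵖ) (n : N),
        (∑ t, g t) • n = ∑ t, g t • n := fun N _ _ g n => Finset.sum_smul
    exact Finset.sum_congr rfl fun _ _ => aux (CycSum R r) _ _
  choose c hc using hc
  refine ⟨fun k t => B t k, fun k => Finsupp.onFinset (∑ t, B t k • a t).support
    (fun j => if j ∈ (∑ t, B t k • a t).support then c k j else 0) (by
      intro j hj; by_contra hj'; simp [hj'] at hj), hB, fun k => ?_⟩
  ext j
  rw [Finsupp.smul_apply, Finsupp.onFinset_apply]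
  split_ifs with hj
  · exact hc k j
  · simpa using hj

lemma rdCrit_of_directLimit {ι : Type u} [Preorder ι] [IsDirected ι (· ≤ ·)] [Nonempty ι]
    [DecidableEq ι] (G : ι → Type u) [∀ i, AddCommGroup (G i)] [∀ i, Module Rᵐᵒᵖ (G i)]
    (f : ∀ i j, i ≤ j → G i →ₗ[Rᵐᵒᵖ] G j) [DirectedSystem G fun i j h => f i j h]
    (hG : ∀ i, ∃ (n : ℕ) (r : Fin n → R), Nonempty (G i ≃ₗ[Rᵐᵒᵖ] CycSum R r))
    (e : M ≃ₗ[Rᵐᵒᵖ] Module.DirectLimit G f) : RDCrit R M := by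
  classical
  intro T _ J x a hxa
  choose i z hz using fun t => Module.DirectLimit.exists_of (e (x t))
  obtain ⟨i₀, hi₀⟩ := Finite.exists_le i
  let s : Finset J := Finset.univ.biUnion fun t => (a t).support
  have hs : ∀ t j, j ∉ s → a t j = 0 := by
    intro t j hj
    by_contra h
    exact hj (Finset.mem_biUnion.2 ⟨t, Finset.mem_univ t, Finsupp.mem_support_iff.2 h⟩)
  let z₀ : T → G i₀ := fun t => f _ _ (hi₀ t) (z t)
  have hz₀ : ∀ t, Module.DirectLimit.of Rᵐᵒᵖ ι G f i₀ (z₀ t) = e (x t) := by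
    intro t; rw [← hz]; exact Module.DirectLimit.of_f
  have hk : ∀ j, ∃ k, ∃ h : i₀ ≤ k, f i₀ k h (∑ t, op (a t j) • z₀ t) = 0 := by
    intro j
    apply Module.DirectLimit.of.zero_exact
    simp only [map_sum, map_smul, hz₀]
    simp only [← map_smul, ← map_sum, hxa, map_zero]
  choose k hk hk' using hk
  obtain ⟨i₁, hi₁⟩ := Finite.exists_le (fun o : Option s => o.elim i₀ (fun j => k j))
  have h01 : i₀ ≤ i₁ := hi₁ none
  let z₁ : T → G i₁ := fun t => f _ _ h01 (z₀ t)
  have hz₁ : ∀ t, Module.DirectLimit.of Rᵐᵒᵖ ι G f i₁ (z₁ t) = e (x t) := by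
    intro t; rw [← hz₀]; exact Module.DirectLimit.of_f
  have hz₁' : ∀ j, ∑ t, op (a t j) • z₁ t = 0 := by
    intro j
    by_cases hj : j ∈ s
    · have hle : k j ≤ i₁ := hi₁ (some ⟨j, hj⟩)
      have := congrArg (f _ _ hle) (hk' j)
      erw [DirectedSystem.map_map (f := fun i j h => f i j h)] at this
      simpa [z₁] using this
    · simp [hs _ j hj]
  obtain ⟨n, r, ⟨g⟩⟩ := hG i₁
  obtain ⟨B, C, hB, hC⟩ := cycSum_rdCrit r (fun t => g (z₁ t)) a (by
    intro j
    simp only [← map_smul, ← map_sum, hz₁', map_zero])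
  let φ : CycSum R r →ₗ[Rᵐᵒᵖ] M := e.symm.toLinearMap.comp
    ((Module.DirectLimit.of Rᵐᵒᵖ ι G f i₁).comp g.symm.toLinearMap)
  refine ⟨n, fun k => φ (cycGen r k), r, B, C, fun k => ?_, fun t => ?_, hC⟩
  · rw [← map_smul, cycGen_rel, map_zero]
  · simp only [← map_smul, ← map_sum]
    rw [← hB]
    simp [φ, hz₁]

end Cyc

section Limit

open CategoryTheory

variable {R : Type u} [Ring R] {M : Type u} [AddCommGroup M] [Module Rᵐᵒᵖ M]

/-- Finite direct sums of cyclically presented modules over `M`. -/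
structure CycOver (R : Type u) [Ring R] (M : Type u) [AddCommGroup M] [Module Rᵐᵒᵖ M] :
    Type u where
  n : ℕ
  r : Fin n → R
  π : CycSum R r →ₗ[Rᵐᵒᵖ] M

/-- Morphisms over `M`. -/
@[ext]
structure CycOver.Hom (c d : CycOver R M) : Type u where
  φ : CycSum R c.r →ₗ[Rᵐᵒᵖ] CycSum R d.r
  comm : d.π.comp φ = c.π

instance : Category.{u} (CycOver R M) where
  Hom c d := CycOver.Hom c d
  id c := ⟨LinearMap.id, rfl⟩
  comp f g := ⟨g.φ.comp f.φ, by rw [← LinearMap.comp_assoc, g.comm, f.comm]⟩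

lemma sum_diag_smul {N : Type u} [AddCommGroup N] [Module Rᵐᵒᵖ N] {T : Type} [Fintype T]
    [DecidableEq T] (r : T → R) (X : T → N) (j : T) :
    ∑ t, op (if t = j then r t else 0) • X t = op (r j) • X j := by
  rw [Finset.sum_eq_single j (fun i _ hi => by simp [hi]) (by simp)]
  simp

lemma directLimit_injective {ι : Type u} [Preorder ι] [IsDirected ι (· ≤ ·)] [Nonempty ι]
    [DecidableEq ι] (G : ι → Type u) [∀ i, AddCommGroup (G i)] [∀ i, Module Rᵐᵒᵖ (G i)]
    (f : ∀ i j, i ≤ j → G i →ₗ[Rᵐᵒᵖ] G j) [DirectedSystem G fun i j h => f i j h]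
    (P : Module.DirectLimit G f →ₗ[Rᵐᵒᵖ] M)
    (hP : ∀ i z, P (Module.DirectLimit.of Rᵐᵒᵖ ι G f i z) = 0 →
      ∃ j k, ∃ (hij : i ≤ j) (hjk : j ≤ k), f j k hjk (f i j hij z) = 0) :
    Function.Injective P := by
  refine (injective_iff_map_eq_zero P).2 ?_
  intro m hm
  obtain ⟨i, z, rfl⟩ := Module.DirectLimit.exists_of m
  obtain ⟨j, k, hij, hjk, h⟩ := hP i z hm
  rw [← Module.DirectLimit.of_f (hij := hij), ← Module.DirectLimit.of_f (hij := hjk), h, map_zero]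

lemma RDCrit.factor (hM : RDCrit R M) {T J : Type} [Fintype T] [Fintype J]
    (x : T → M) (a : T → J → R) (h : ∀ j, ∑ t, op (a t j) • x t = 0) :
    ∃ (c : CycOver R M) (X : T → CycSum R c.r), (∀ t, c.π (X t) = x t) ∧
      ∀ j, ∑ t, op (a t j) • X t = 0 := by
  obtain ⟨p, y, r, B, C, hy, hB, hC⟩ := hM T (ULift.{u} J) x
    (fun t => Finsupp.equivFunOnFinite.symm fun j => a t j.down) (fun j => by simpa using h j.down)
  obtain ⟨g, hg⟩ := exists_cycLift r y hy
  refine ⟨⟨p, r, g⟩, fun t => cycMk r fun k => B k t, fun t => ?_, fun j => ?_⟩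
  · simp [cycMk_eq_sum, hg, hB]
  · have : cycMk r (fun k => ∑ t, B k t * a t j) = 0 := by
      rw [cycMk_eq_zero]
      intro k
      refine ⟨C k ⟨j⟩, ?_⟩
      have := DFunLike.congr_fun (hC k) ⟨j⟩
      simpa [Finsupp.finsetSum_apply] using this
    rw [← this]
    ext k
    simp only [Finset.sum_apply, Pi.smul_apply, cycMk,
      ← Submodule.mkQ_apply, ← map_smul, ← map_sum]
    rfl

/-- One can kill finitely many elements of the kernel of `c.π`. -/
lemma RDCrit.kill (hM : RDCrit R M) (c : CycOver R M) {L : Type} [Fintype L]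
    (z : L → CycSum R c.r) (hz : ∀ l, c.π (z l) = 0) :
    ∃ (d : CycOver R M) (f : c ⟶ d), ∀ l, f.φ (z l) = 0 := by
  classical
  choose a ha using fun l => cyc_gen_sum c.r (z l)
  obtain ⟨d, X, hX, hX'⟩ := hM.factor (T := Fin c.n) (J := Fin c.n ⊕ L)
    (fun k => c.π (cycGen c.r k))
    (fun k => Sum.elim (fun j => if k = j then c.r k else 0) (fun l => a l k)) (by
      rintro (j | l)
      · rw [Finset.sum_eq_single j (fun i _ hi => by simp [hi]) (by simp)]
        simp only [Sum.elim_inl, if_true]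
        rw [← map_smul, cycGen_rel, map_zero]
      · simp only [Sum.elim_inr, ← map_smul, ← map_sum]
        rw [← ha, hz])
  obtain ⟨g, hg⟩ := exists_cycLift c.r X (by
    intro j
    have := hX' (Sum.inl j)
    exact (sum_diag_smul c.r X j).symm.trans this)
  refine ⟨d, ⟨g, ?_⟩, fun l => ?_⟩
  · apply cyc_hom_ext
    intro k
    simp [hg, hX]
  · have := hX' (Sum.inr l)
    change g (z l) = 0
    rw [ha]
    simpa [hg] using this

lemma RDCrit.isFiltered (hM : RDCrit R M) : IsFiltered (CycOver R M) where
  nonempty := ⟨⟨0, Fin.elim0, 0⟩⟩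
  cocone_objs c d := by
    classical
    let rr : Fin c.n ⊕ Fin d.n → R := Sum.elim c.r d.r
    let xx : Fin c.n ⊕ Fin d.n → M :=
      Sum.elim (fun k => c.π (cycGen c.r k)) (fun k => d.π (cycGen d.r k))
    obtain ⟨e, X, hX, hX'⟩ := hM.factor (J := Fin c.n ⊕ Fin d.n) xx
      (fun t j => if t = j then rr t else 0) (by
        intro j
        rw [Finset.sum_eq_single j (fun i _ hi => by simp [hi]) (by simp)]
        rcases j with j | j
        all_goals
          simp only [if_true, xx, rr, Sum.elim_inl, Sum.elim_inr]
          rw [← map_smul, cycGen_rel, map_zero])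
    have hX'' : ∀ j, op (rr j) • X j = 0 := by
      intro j
      have := hX' j
      exact (sum_diag_smul rr X j).symm.trans this
    obtain ⟨g, hg⟩ := exists_cycLift c.r (fun k => X (Sum.inl k)) (fun k => hX'' (Sum.inl k))
    obtain ⟨g', hg'⟩ := exists_cycLift d.r (fun k => X (Sum.inr k)) (fun k => hX'' (Sum.inr k))
    refine ⟨e, ⟨g, ?_⟩, ⟨g', ?_⟩, trivial⟩
    · apply cyc_hom_ext
      intro k
      simp [hg, hX, xx]
    · apply cyc_hom_ext
      intro k
      simp [hg', hX, xx]
  cocone_maps c d f g := by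
    obtain ⟨e, h, hh⟩ := hM.kill d (fun k => f.φ (cycGen c.r k) - g.φ (cycGen c.r k)) (by
      intro k
      rw [map_sub, ← LinearMap.comp_apply, ← LinearMap.comp_apply, f.comm, g.comm, sub_self])
    refine ⟨e, h, ?_⟩
    apply CycOver.Hom.ext
    apply cyc_hom_ext
    intro k
    have := hh k
    rw [map_sub, sub_eq_zero] at this
    exact this

lemma RDCrit.exists_directLimit (hM : RDCrit R M) :
    ∃ (ι : Type u) (_ : Preorder ι) (_ : IsDirected ι (· ≤ ·)) (_ : Nonempty ι)
        (_ : DecidableEq ι) (G : ι → Type u) (_ : ∀ i, AddCommGroup (G i))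
        (_ : ∀ i, Module Rᵐᵒᵖ (G i)) (f : ∀ i j, i ≤ j → G i →ₗ[Rᵐᵒᵖ] G j)
        (_ : DirectedSystem G fun i j h => f i j h),
        (∀ i, ∃ (n : ℕ) (r : Fin n → R), Nonempty (G i ≃ₗ[Rᵐᵒᵖ] CycSum R r)) ∧
        Nonempty (M ≃ₗ[Rᵐᵒᵖ] Module.DirectLimit G f) := by
  classical
  have := hM.isFiltered
  obtain ⟨α, _, _, _, F, _⟩ := IsFiltered.exists_directed (CycOver R M)
  let G : α → Type u := fun i => CycSum R (F.obj i).r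
  let f : ∀ i j, i ≤ j → G i →ₗ[Rᵐᵒᵖ] G j := fun i j h => (F.map (homOfLE h)).φ
  have hds : DirectedSystem G fun i j h => f i j h :=
    { map_self := by
        intro i x
        change (F.map (𝟙 i)).φ x = x
        rw [F.map_id]; rfl
      map_map := by
        intro k j i hij hjk x
        change _ = (F.map (homOfLE hij ≫ homOfLE hjk)).φ x
        rw [F.map_comp]; rfl }
  let P : Module.DirectLimit G f →ₗ[Rᵐᵒᵖ] M :=
    Module.DirectLimit.lift Rᵐᵒᵖ α G f (fun i => (F.obj i).π) (by
      intro i j h x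
      exact LinearMap.congr_fun (F.map (homOfLE h)).comm x)
  have hfin := (Functor.final_iff_of_isFiltered F).1 inferInstance
  have hbij : Function.Bijective P := by
    constructor
    · refine directLimit_injective G f P ?_
      intro i z hm
      have hz : (F.obj i).π z = 0 := by
        refine Eq.trans ?_ hm
        symm
        apply Module.DirectLimit.lift_of
      obtain ⟨d, h, hh⟩ := hM.kill (F.obj i) (fun _ : Unit => z) (fun _ => hz)
      obtain ⟨j, ⟨s⟩⟩ := hfin.1 d
      obtain ⟨k, hik, hjk⟩ := exists_ge_ge i j
      obtain ⟨k', t, ht⟩ := hfin.2 (F.map (homOfLE hik)) (h ≫ s ≫ F.map (homOfLE hjk))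
      have hkk' : k ≤ k' := leOfHom t
      have h1 : f k k' hkk' (f i k hik z) = 0 := by
        have := congrArg (fun q => CycOver.Hom.φ q z) ht
        change (F.map t).φ ((F.map (homOfLE hik)).φ z) = 0
        refine this.trans ?_
        change (F.map t).φ ((F.map (homOfLE hjk)).φ (s.φ (h.φ z))) = 0
        rw [hh ()]
        simp
      exact ⟨k, k', hik, hkk', h1⟩
    · intro m
      obtain ⟨c, X, hX, -⟩ := hM.factor (T := Unit) (J := Empty) (fun _ => m) (fun _ j => j.elim)
        (fun j => j.elim)
      obtain ⟨j, ⟨s⟩⟩ := hfin.1 c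
      refine ⟨Module.DirectLimit.of Rᵐᵒᵖ α G f j (s.φ (X ())), ?_⟩
      refine (Module.DirectLimit.lift_of _ _ _).trans ?_
      rw [← hX ()]
      exact LinearMap.congr_fun s.comm _
  exact ⟨α, inferInstance, inferInstance, inferInstance, inferInstance, G, inferInstance,
    inferInstance, f, hds, fun i => ⟨_, _, ⟨LinearEquiv.refl _ _⟩⟩,
    ⟨(LinearEquiv.ofBijective P hbij).symm⟩⟩

end Limit

/-- A right `R`-module `M` is RD-flat if and only if `M` is a direct limit of finite
direct sums of cyclically presented right `R`-modules `R/rR`. -/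
theorem rdFlat_iff_directLimit_of_cyclicallyPresented (R : Type u) [Ring R]
    (M : Type u) [AddCommGroup M] [Module Rᵐᵒᵖ M] :
    RDFlat R M ↔
      ∃ (ι : Type u) (_ : Preorder ι) (_ : IsDirected ι (· ≤ ·)) (_ : Nonempty ι)
        (_ : DecidableEq ι) (G : ι → Type u) (_ : ∀ i, AddCommGroup (G i))
        (_ : ∀ i, Module Rᵐᵒᵖ (G i)) (f : ∀ i j, i ≤ j → G i →ₗ[Rᵐᵒᵖ] G j)
        (_ : DirectedSystem G fun i j h => f i j h),
        (∀ i, ∃ (n : ℕ) (r : Fin n → R),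
          Nonempty (G i ≃ₗ[Rᵐᵒᵖ]
            ∀ k : Fin n, R ⧸ (Submodule.span Rᵐᵒᵖ {r k} : Submodule Rᵐᵒᵖ R))) ∧
        Nonempty (M ≃ₗ[Rᵐᵒᵖ] Module.DirectLimit G f) := by
  constructor
  · intro h
    exact h.rdCrit.exists_directLimit
  · rintro ⟨ι, _, _, _, _, G, _, _, f, _, hG, ⟨e⟩⟩
    exact (rdCrit_of_directLimit G f hG e).rdFlat
end

section
/- Let R be a commutative artinian ring. Then R is RD-injective as an R-module if and only if R is quasi-Frobenius (i.e. R is self-injective). -/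
universe u

open MulOpposite

section RDDefsComm

variable (R : Type u) [CommRing R]

/-- `IsTensorZeroC R M N l` encodes the statement `∑ mᵢ ⊗ nᵢ = 0` in `M ⊗_R N`
(modules over a commutative ring `R`), via the universal property of the tensor
product: every `R`-balanced biadditive map kills the sum. -/
def IsTensorZeroC (M N : Type u) [AddCommGroup M] [Module R M]
    [AddCommGroup N] [Module R N] (l : List (M × N)) : Prop :=
  ∀ (A : Type u) [AddCommGroup A], ∀ b : M → N → A,
    (∀ m₁ m₂ n, b (m₁ + m₂) n = b m₁ n + b m₂ n) →
    (∀ m n₁ n₂, b m (n₁ + n₂) = b m n₁ + b m n₂) →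
    (∀ (r : R) (m : M) (n : N), b (r • m) n = b m (r • n)) →
    (l.map fun p => b p.1 p.2).sum = 0

/-- An `R`-module `M` (over a commutative ring) is RD-flat if tensoring with `M`
preserves exactness of all RD-exact sequences; equivalently, for every injective
linear map `f : H → F` whose image is a relatively divisible submodule
(`rF ∩ f(H) = r f(H)` for all `r`), the induced map `M ⊗ H → M ⊗ F` is injective. -/
def RDFlatC (M : Type u) [AddCommGroup M] [Module R M] : Prop :=
  ∀ (H F : Type u) [AddCommGroup H] [Module R H] [AddCommGroup F] [Module R F],
    ∀ f : H →ₗ[R] F, Function.Injective f →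
    (∀ (r : R) (h : H) (y : F), f h = r • y → ∃ h' : H, h = r • h') →
    ∀ l : List (M × H),
      IsTensorZeroC R M F (l.map fun p => (p.1, f p.2)) → IsTensorZeroC R M H l

/-- An `R`-module `N` is RD-injective if every homomorphism into `N` from a
relatively divisible submodule of an `R`-module extends to the whole module. -/
def RDInjectiveC (N : Type u) [AddCommGroup N] [Module R N] : Prop :=
  ∀ (K L : Type u) [AddCommGroup K] [Module R K] [AddCommGroup L] [Module R L],
    ∀ f : K →ₗ[R] L, Function.Injective f →
    (∀ (r : R) (k : K) (y : L), f k = r • y → ∃ k' : K, k = r • k') →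
    ∀ g : K →ₗ[R] N, ∃ h : L →ₗ[R] N, h.comp f = g

/-- An injective linear map `f : K → L` of `R`-modules is pure if every finite
system of linear equations with constants in `K` which is solvable in `L` is
solvable in `K`. -/
def IsPureC {K L : Type u} [AddCommGroup K] [Module R K] [AddCommGroup L]
    [Module R L] (f : K →ₗ[R] L) : Prop :=
  ∀ (m n : ℕ) (a : Fin m → Fin n → R) (k : Fin m → K),
    (∃ x : Fin n → L, ∀ i, (∑ j, a i j • x j) = f (k i)) →
    ∃ y : Fin n → K, ∀ i, (∑ j, a i j • y j) = k i

/-- An `R`-module `M` is RD-coflat if every RD-exact sequence `0 → M → P → Q → 0`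
is pure-exact, i.e. whenever `M` embeds as a relatively divisible submodule of a
module `P`, it is a pure submodule of `P`. -/
def RDCoflatC (M : Type u) [AddCommGroup M] [Module R M] : Prop :=
  ∀ (P : Type u) [AddCommGroup P] [Module R P],
    ∀ f : M →ₗ[R] P, Function.Injective f →
    (∀ (r : R) (x : M) (y : P), f x = r • y → ∃ x' : M, x = r • x') →
    IsPureC R f

/-- An `R`-module `F` is RD-projective if every homomorphism from `F` to a quotient
in an RD-exact sequence (the kernel is a relatively divisible submodule) lifts. -/
def RDProjectiveC (F : Type u) [AddCommGroup F] [Module R F] : Prop :=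
  ∀ (L Q : Type u) [AddCommGroup L] [Module R L] [AddCommGroup Q] [Module R Q],
    ∀ p : L →ₗ[R] Q, Function.Surjective p →
    (∀ (r : R) (x : L), p x = 0 → (∃ y : L, x = r • y) →
      ∃ z : L, p z = 0 ∧ x = r • z) →
    ∀ g : F →ₗ[R] Q, ∃ h : F →ₗ[R] L, p.comp h = g

end RDDefsComm

/-- Over an artinian local ring, every nonzero element has a nonzero multiple in the socle. -/
lemma rdqf_exists_mul_mem_socle (R : Type u) [CommRing R] [IsArtinianRing R] [IsLocalRing R]
    (r : R) (hr : r ≠ 0) :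
    ∃ t : R, t * r ≠ 0 ∧ t * r ∈ Submodule.torsionBySet R R (IsLocalRing.maximalIdeal R) := by
  have hn : IsNilpotent (IsLocalRing.maximalIdeal R) := by
    have := IsArtinianRing.isNilpotent_jacobson_bot (R := R)
    rwa [IsLocalRing.jacobson_eq_maximalIdeal ⊥ bot_ne_top] at this
  obtain ⟨N, hN⟩ := hn
  have hex : ∃ n : ℕ, ∀ t ∈ (IsLocalRing.maximalIdeal R) ^ n, t * r = 0 := by
    refine ⟨N, fun t ht => ?_⟩
    rw [hN] at ht
    have : t = 0 := by simpa using ht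
    simp [this]
  classical
  have hspec := Nat.find_spec hex
  have hmin := fun k => Nat.find_min hex (m := k)
  generalize Nat.find hex = n at hspec hmin
  rcases n with _ | n
  · exact absurd (by simpa using hspec 1 (by simp)) hr
  · have := hmin n (Nat.lt_succ_self n)
    push Not at this
    obtain ⟨t, ht, htr⟩ := this
    refine ⟨t, htr, ?_⟩
    rw [Submodule.mem_torsionBySet_iff]
    rintro ⟨a, ha⟩
    have h1 : t * a ∈ (IsLocalRing.maximalIdeal R) ^ (n + 1) := by
      rw [pow_succ]
      exact Ideal.mul_mem_mul ht ha
    have h2 := hspec _ h1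
    change a * (t * r) = 0
    rw [← h2]
    ring

/-- The key step: a linear map from a product of the proper cyclic modules `R / sR`, `s ≠ 0`,
to an artinian local ring sends the vector `1` to a nonunit. -/
lemma rdqf_not_isUnit (R : Type u) [CommRing R] [IsArtinianRing R] [IsLocalRing R]
    (ρ : (∀ s : {s : R // s ≠ 0}, R ⧸ Ideal.span {s.1}) →ₗ[R] R) :
    ¬ IsUnit (ρ (fun _ => 1)) := by
  intro hu
  let m := IsLocalRing.maximalIdeal R
  let S : Submodule R R := Submodule.torsionBySet R R m
  let _ : Field (R ⧸ m) := Ideal.Quotient.field m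
  let _ : Module (R ⧸ m) S :=
    inferInstanceAs (Module (R ⧸ m) (Submodule.torsionBySet R R m))
  have : IsScalarTower R (R ⧸ m) S := ⟨by
    intro x y z
    obtain ⟨y, rfl⟩ := Ideal.Quotient.mk_surjective y
    change (x * y) • z = x • (y • z)
    exact mul_smul x y z⟩
  have : Module.Finite (R ⧸ m) S := Module.Finite.of_restrictScalars_finite R (R ⧸ m) S
  let b := Module.finBasis (R ⧸ m) S
  let ι := Fin (Module.finrank (R ⧸ m) S)
  let lam : ι → S →ₗ[R] (R ⧸ m) := fun i => (b.coord i).restrictScalars R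
  have hlam : ∀ s : S, s ≠ 0 → ∃ i, lam i s ≠ 0 := by
    intro s hs
    by_contra! hcon
    exact hs (b.forall_coord_eq_zero_iff.mp hcon)
  let Lam : (ι → S) →ₗ[R] (R ⧸ m) := ∑ i, (lam i).comp (LinearMap.proj i)
  have hLam : ∀ i s, Lam (Pi.single i s) = lam i s := by
    intro i s
    simp only [Lam, LinearMap.sum_apply, LinearMap.comp_apply, LinearMap.proj_apply]
    rw [Finset.sum_eq_single i]
    · simp
    · intro j _ hj
      simp [Pi.single_eq_of_ne hj]
    · simp
  let incl : (ι → S) →ₗ[R] (ι → R) := S.subtype.compLeft ι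
  have hincl : Function.Injective incl := by
    intro x y hxy
    funext i
    exact Subtype.ext (congrFun hxy i)
  let K : Submodule R (ι → R) := (LinearMap.ker Lam).map incl
  -- the element `c`
  obtain ⟨c, hc⟩ : ∃ c : ι → S, Lam c ≠ 0 := by
    obtain ⟨t, ht0, htS⟩ := rdqf_exists_mul_mem_socle R 1 one_ne_zero
    obtain ⟨i, hi⟩ := hlam ⟨t * 1, htS⟩ (fun h => ht0 (congrArg Subtype.val h))
    exact ⟨Pi.single i ⟨t * 1, htS⟩, by rwa [hLam]⟩
  have key : ∀ r : {s : R // s ≠ 0}, ∃ q ∈ K, ∃ w : ι → R, incl c = q + r.1 • w := by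
    rintro ⟨r, hr⟩
    obtain ⟨t, ht0, htS⟩ := rdqf_exists_mul_mem_socle R r hr
    obtain ⟨i, hi⟩ := hlam ⟨t * r, htS⟩ (fun h => ht0 (congrArg Subtype.val h))
    obtain ⟨x, hx⟩ := Ideal.Quotient.mk_surjective (Lam c / lam i ⟨t * r, htS⟩)
    have hx' : x • lam i ⟨t * r, htS⟩ = Lam c := by
      rw [Algebra.smul_def, Ideal.Quotient.algebraMap_eq, hx, div_mul_cancel₀ _ hi]
    refine ⟨incl (c - x • Pi.single (M := fun _ => S) i ⟨t * r, htS⟩), Submodule.mem_map_of_mem ?_,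
      Pi.single i (x * t), ?_⟩
    · rw [LinearMap.mem_ker, map_sub, map_smul, hLam, hx', sub_self]
    · rw [map_sub, map_smul]
      have : x • incl (Pi.single (M := fun _ => S) i ⟨t * r, htS⟩) = r • (Pi.single i (x * t) : ι → R) := by
        funext j
        by_cases hj : j = i
        · subst hj
          simp [incl]
          ring
        · simp [incl, Pi.single_eq_of_ne hj]
      rw [this]
      abel
  have hKfg : K.FG := IsNoetherian.noetherian K
  obtain ⟨a, A, hA⟩ := Submodule.fg_iff_exists_fin_generating_family.mp hKfg
  choose q hqK w hw using key
  have hz : ∀ r, ∃ z : Fin a → R, ∑ i, z i • A i = q r := by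
    intro r
    have := hqK r
    rw [← hA] at this
    exact (Submodule.mem_span_range_iff_exists_fun R).mp this
  choose z hz using hz
  let Z : Fin a → (∀ s : {s : R // s ≠ 0}, R ⧸ Ideal.span {s.1}) :=
    fun i s => Ideal.Quotient.mk _ (z s i)
  have hZ : ∀ j : ι, (incl c j) • (fun _ => 1 : ∀ s : {s : R // s ≠ 0}, R ⧸ Ideal.span {s.1})
      = ∑ i, A i j • Z i := by
    intro j
    funext s
    have h1 := congrFun (hw s) j
    rw [← hz s] at h1
    simp only [Pi.add_apply, Finset.sum_apply, Pi.smul_apply, smul_eq_mul] at h1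
    simp only [Pi.smul_apply, Finset.sum_apply, Z, Algebra.smul_def, Ideal.Quotient.algebraMap_eq,
      mul_one]
    rw [h1]
    simp only [map_add, map_sum, map_mul]
    have h0 : (Ideal.Quotient.mk (Ideal.span {s.1})) s.1 = 0 :=
      Ideal.Quotient.eq_zero_iff_mem.mpr (Ideal.mem_span_singleton_self _)
    rw [h0, zero_mul, add_zero]
    exact Finset.sum_congr rfl fun i _ => mul_comm _ _
  set v := ρ (fun _ => 1) with hv
  have hmem : incl (v • c) ∈ K := by
    have : incl (v • c) = ∑ i, ρ (Z i) • A i := by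
      funext j
      have h1 := congrArg ρ (hZ j)
      rw [map_smul, map_sum, ← hv] at h1
      simp only [map_smul, smul_eq_mul] at h1
      rw [map_smul]
      simp only [Pi.smul_apply, Finset.sum_apply, smul_eq_mul]
      rw [mul_comm, h1]
      exact Finset.sum_congr rfl fun i _ => mul_comm _ _
    rw [this, ← hA]
    exact Submodule.sum_mem _ fun i _ =>
      Submodule.smul_mem _ _ (Submodule.subset_span (Set.mem_range_self i))
  obtain ⟨y, hy, hyc⟩ := hmem
  rw [hincl hyc] at hy
  have hy' : Lam (v • c) = 0 := hy
  rw [map_smul] at hy'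
  exact hc ((hu.smul_eq_zero).mp hy')

/-- Every module embeds in an injective module. -/
lemma rdqf_exists_injective (R : Type u) [CommRing R] :
    ∃ (I : ModuleCat.{u} R) (f : R →ₗ[R] I), Module.Injective R I ∧ Function.Injective f := by
  let P := CategoryTheory.EnoughInjectives.presentation (ModuleCat.of R R)
  obtain ⟨P⟩ := P
  refine ⟨P.J, P.f.hom, ?_, ?_⟩
  · have := P.injective
    exact (Module.injective_iff_injective_object R _).mpr this
  · exact (ModuleCat.mono_iff_injective P.f).mp P.mono

/-- The local case. -/
lemma rdqf_local (R : Type u) [CommRing R] [IsArtinianRing R] [IsLocalRing R]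
    (h : RDInjectiveC R R) : Module.Injective R R := by
  obtain ⟨I, j, hI, hj⟩ := rdqf_exists_injective R
  let P := ∀ s : {s : R // s ≠ 0}, R ⧸ Ideal.span {s.1}
  let d : R →ₗ[R] P := LinearMap.toSpanSingleton R P (fun _ => 1)
  have hd : ∀ a s, d a s = Ideal.Quotient.mk _ a := by
    intro a s
    change a • (1 : R ⧸ Ideal.span {s.1}) = _
    rw [Algebra.smul_def, mul_one, Ideal.Quotient.algebraMap_eq]
  obtain ⟨ρ, hρ⟩ := h R (I × P) (j.prod d) (fun x y hxy => hj (congrArg Prod.fst hxy)) (by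
    intro r k y hy
    by_cases hr : r = 0
    · subst hr
      refine ⟨0, ?_⟩
      have h1 : j k = (0 : R) • y.1 := congrArg Prod.fst hy
      rw [zero_smul] at h1
      rw [smul_zero]
      exact hj (by rw [h1, map_zero])
    · have h1 : d k = r • y.2 := congrArg Prod.snd hy
      have h2 := congrFun h1 ⟨r, hr⟩
      rw [hd, Pi.smul_apply] at h2
      obtain ⟨y', hy'⟩ := Ideal.Quotient.mk_surjective (y.2 ⟨r, hr⟩)
      have h0 : (Ideal.Quotient.mk (Ideal.span {r})) r = 0 :=
        Ideal.Quotient.eq_zero_iff_mem.mpr (Ideal.mem_span_singleton_self _)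
      rw [Algebra.smul_def, Ideal.Quotient.algebraMap_eq, h0, zero_mul,
        Ideal.Quotient.eq_zero_iff_mem, Ideal.mem_span_singleton] at h2
      obtain ⟨k', hk'⟩ := h2
      exact ⟨k', hk'⟩) LinearMap.id
  let ρ₁ : I →ₗ[R] R := ρ.comp (LinearMap.inl R I P)
  let ρ₂ : P →ₗ[R] R := ρ.comp (LinearMap.inr R I P)
  have hsum : ρ₁ (j 1) + ρ₂ (fun _ => 1) = 1 := by
    have h1 := LinearMap.congr_fun hρ 1
    have h2 : (j.prod d) 1 = LinearMap.inl R I P (j 1) + LinearMap.inr R I P (fun _ => 1) := by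
      ext1
      · simp
      · simp [d]
    rw [LinearMap.comp_apply, h2, map_add] at h1
    exact h1
  have hu : IsUnit (ρ₁ (j 1)) := by
    rcases IsLocalRing.isUnit_or_isUnit_of_add_one hsum with h1 | h1
    · exact h1
    · exact absurd h1 (rdqf_not_isUnit R ρ₂)
  obtain ⟨u, hu⟩ := hu
  refine ⟨fun X Y _ _ _ _ f hf g => ?_⟩
  obtain ⟨g', hg'⟩ := hI.out f hf (j.comp g)
  refine ⟨(↑u⁻¹ : R) • (ρ₁.comp g'), fun x => ?_⟩
  have h1 : j (g x) = g x • j 1 := by rw [← map_smul, smul_eq_mul, mul_one]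
  simp only [LinearMap.smul_apply, LinearMap.comp_apply, hg', h1, map_smul, ← hu, smul_eq_mul]
  rw [mul_comm (g x), ← mul_assoc, Units.inv_mul, one_mul]

/-- RD-injectivity of an artinian ring passes to localizations. -/
lemma rdqf_localization (R : Type u) [CommRing R] [IsArtinianRing R]
    (h : RDInjectiveC R R) (M : Submonoid R) :
    RDInjectiveC (Localization M) (Localization M) := by
  have hs : Function.Surjective (algebraMap R (Localization M)) :=
    IsArtinianRing.localization_surjective M _
  have : Module.Finite R (Localization M) :=
    Module.Finite.of_surjective (Algebra.linearMap R (Localization M)) hs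
  have : Module.Flat R (Localization M) := IsLocalization.flat _ M
  have : Module.FinitePresentation R (Localization M) := Module.finitePresentation_of_finite R _
  have : Module.Projective R (Localization M) := Module.Flat.projective_of_finitePresentation
  obtain ⟨i, hi⟩ := Module.projective_lifting_property
    (Algebra.linearMap R (Localization M)) LinearMap.id hs
  intro K L _ _ _ _ f hf hRD g
  let _ : Module R K := Module.compHom K (algebraMap R (Localization M))
  let _ : Module R L := Module.compHom L (algebraMap R (Localization M))
  have : IsScalarTower R (Localization M) K := .of_algebraMap_smul fun _ _ => rfl
  have : IsScalarTower R (Localization M) L := .of_algebraMap_smul fun _ _ => rfl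
  obtain ⟨e, he⟩ := h K L (f.restrictScalars R) hf
    (fun r k y hk => hRD (algebraMap R _ r) k y hk) (i.comp (g.restrictScalars R))
  let e' : L →ₗ[R] Localization M := (Algebra.linearMap R (Localization M)).comp e
  refine ⟨{ toFun := e', map_add' := e'.map_add, map_smul' := ?_ }, ?_⟩
  · intro r x
    obtain ⟨r, rfl⟩ := hs r
    rw [algebraMap_smul, map_smul, RingHom.id_apply, algebraMap_smul]
  · ext x
    have h1 := LinearMap.congr_fun he x
    have h2 := LinearMap.congr_fun hi (g x)
    change Algebra.linearMap R (Localization M) (e (f x)) = g x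
    change e (f x) = i (g x) at h1
    rw [h1]
    exact h2

/-- A commutative artinian ring `R` is RD-injective as a module over itself if and
only if `R` is quasi-Frobenius, i.e. injective as a module over itself. -/
theorem rdInjective_self_iff_quasiFrobenius (R : Type u) [CommRing R]
    [IsArtinianRing R] :
    RDInjectiveC R R ↔ Module.Injective R R := by
  constructor
  · intro h
    apply Module.injective_of_localization_maximal
    intro m hm
    have : IsArtinianRing (Localization.AtPrime m) :=
      IsArtinianRing.localization_artinian m.primeCompl _
    exact rdqf_local (Localization.AtPrime m) (rdqf_localization R h m.primeCompl)
  · intro h K L _ _ _ _ f hf _ g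
    obtain ⟨e, he⟩ := h.out f hf g
    exact ⟨e, LinearMap.ext he⟩
end

section
/- Over a ring R, every left R-module is RD-coflat if and only if every left pure-injective R-module is RD-injective. -/
universe u

open MulOpposite

section RDDefsLeft

variable (R : Type u) [Ring R]

/-- A left `R`-module `N` is RD-injective if every homomorphism into `N` from a
relatively divisible submodule of a left `R`-module extends to the whole module. -/
def RDInjectiveL (N : Type u) [AddCommGroup N] [Module R N] : Prop :=
  ∀ (K L : Type u) [AddCommGroup K] [Module R K] [AddCommGroup L] [Module R L],
    ∀ f : K →ₗ[R] L, Function.Injective f →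
    (∀ (r : R) (k : K) (y : L), f k = r • y → ∃ k' : K, k = r • k') →
    ∀ g : K →ₗ[R] N, ∃ h : L →ₗ[R] N, h.comp f = g

/-- An injective linear map `f : K → L` of left `R`-modules is pure if every finite
system of linear equations `∑ⱼ aᵢⱼ xⱼ = kᵢ` with constants in `K` which is solvable
in `L` is solvable in `K`. -/
def IsPureL {K L : Type u} [AddCommGroup K] [Module R K] [AddCommGroup L]
    [Module R L] (f : K →ₗ[R] L) : Prop :=
  ∀ (m n : ℕ) (a : Fin m → Fin n → R) (k : Fin m → K),
    (∃ x : Fin n → L, ∀ i, (∑ j, a i j • x j) = f (k i)) →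
    ∃ y : Fin n → K, ∀ i, (∑ j, a i j • y j) = k i

/-- A left `R`-module `M` is RD-coflat if every RD-exact sequence `0 → M → P → Q → 0`
is pure-exact, i.e. whenever `M` embeds as a relatively divisible submodule of a left
module `P`, it is a pure submodule of `P`. -/
def RDCoflatL (M : Type u) [AddCommGroup M] [Module R M] : Prop :=
  ∀ (P : Type u) [AddCommGroup P] [Module R P],
    ∀ f : M →ₗ[R] P, Function.Injective f →
    (∀ (r : R) (x : M) (y : P), f x = r • y → ∃ x' : M, x = r • x') →
    IsPureL R f

/-- A left `R`-module `N` is pure-injective if every homomorphism into `N` from a pure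
submodule of a left `R`-module extends to the whole module. -/
def PureInjectiveL (N : Type u) [AddCommGroup N] [Module R N] : Prop :=
  ∀ (K L : Type u) [AddCommGroup K] [Module R K] [AddCommGroup L] [Module R L],
    ∀ f : K →ₗ[R] L, Function.Injective f → IsPureL R f →
    ∀ g : K →ₗ[R] N, ∃ h : L →ₗ[R] N, h.comp f = g

end RDDefsLeft

/-- Characters of the free right module `R^m`. -/
def RDChar (R : Type u) [Ring R] (m : ℕ) : Type u := (Fin m → R) →+ AddCircle (1 : ℚ)

noncomputable instance RDChar.group (R : Type u) [Ring R] (m : ℕ) : AddCommGroup (RDChar R m) :=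
  inferInstanceAs (AddCommGroup ((Fin m → R) →+ AddCircle (1 : ℚ)))

instance RDChar.funLike (R : Type u) [Ring R] (m : ℕ) :
    FunLike (RDChar R m) (Fin m → R) (AddCircle (1 : ℚ)) :=
  inferInstanceAs (FunLike ((Fin m → R) →+ AddCircle (1 : ℚ)) _ _)

instance RDChar.homClass (R : Type u) [Ring R] (m : ℕ) :
    AddMonoidHomClass (RDChar R m) (Fin m → R) (AddCircle (1 : ℚ)) :=
  inferInstanceAs (AddMonoidHomClass ((Fin m → R) →+ AddCircle (1 : ℚ)) _ _)

/-- Right multiplication on `R^m`. -/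
def rdRight (R : Type u) [Ring R] (m : ℕ) (r : R) : (Fin m → R) →+ (Fin m → R) where
  toFun v := fun i => v i * r
  map_zero' := by ext; simp
  map_add' v w := by ext; simp [add_mul]

theorem RDChar.ext' {R : Type u} [Ring R] {m : ℕ} {p q : RDChar R m} (h : ∀ v, p v = q v) :
    p = q := AddMonoidHom.ext h

noncomputable instance RDChar.smul (R : Type u) [Ring R] (m : ℕ) : SMul R (RDChar R m) where
  smul r p := AddMonoidHom.comp (p : (Fin m → R) →+ AddCircle (1 : ℚ)) (rdRight R m r)

theorem RDChar.smul_apply {R : Type u} [Ring R] {m : ℕ} (r : R) (p : RDChar R m) (v) :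
    (r • p) v = p (fun i => v i * r) := rfl

theorem RDChar.add_apply {R : Type u} [Ring R] {m : ℕ} (p q : RDChar R m) (v) :
    (p + q) v = p v + q v := rfl

theorem RDChar.zero_apply {R : Type u} [Ring R] {m : ℕ} (v) :
    (0 : RDChar R m) v = 0 := rfl

noncomputable instance RDChar.module (R : Type u) [Ring R] (m : ℕ) : Module R (RDChar R m) where
  one_smul p := RDChar.ext' fun v => by simp [RDChar.smul_apply]
  mul_smul r s p := RDChar.ext' fun v => by simp [RDChar.smul_apply, mul_assoc]
  smul_zero r := RDChar.ext' fun v => by simp [RDChar.smul_apply, RDChar.zero_apply]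
  smul_add r p q := RDChar.ext' fun v => by simp [RDChar.smul_apply, RDChar.add_apply]
  add_smul r s p := RDChar.ext' fun v => by
    simp only [RDChar.smul_apply, RDChar.add_apply, mul_add, ← map_add]
    rfl
  zero_smul p := RDChar.ext' fun v => by
    simp only [RDChar.smul_apply, RDChar.zero_apply, mul_zero]
    exact map_zero p

/-- The dual of the finitely presented right module given by the matrix `a`. -/
def rdDual {R : Type u} [Ring R] {m n : ℕ} (a : Fin m → Fin n → R) :
    Submodule R (RDChar R m) where
  carrier := {p | ∀ w : Fin n → R, p (fun i => ∑ j, a i j * w j) = 0}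
  zero_mem' w := rfl
  add_mem' {p q} hp hq w := by rw [RDChar.add_apply, hp, hq, add_zero]
  smul_mem' r p hp w := by
    rw [RDChar.smul_apply, ← hp (fun j => w j * r)]
    simp only [Finset.sum_mul, mul_assoc]

/-- Characters of `L^m` killing the image of `a` give maps to the dual. -/
noncomputable def rdMk {R : Type u} [Ring R] {m n : ℕ} (a : Fin m → Fin n → R)
    {L : Type u} [AddCommGroup L] [Module R L] (c : (Fin m → L) →+ AddCircle (1 : ℚ))
    (hc : ∀ y : Fin n → L, c (fun i => ∑ j, a i j • y j) = 0) : L →ₗ[R] rdDual a where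
  toFun l := ⟨(c.comp
      { toFun := fun v i => v i • l
        map_zero' := by ext; simp
        map_add' := fun v w => by ext; simp [add_smul] } : (Fin m → R) →+ AddCircle (1 : ℚ)),
      fun w => by
        rw [← hc (fun j => w j • l)]
        change c (fun i => (∑ j, a i j * w j) • l) = _
        simp only [Finset.sum_smul, mul_smul]⟩
  map_add' l l' := Subtype.ext <| RDChar.ext' fun v => by
    change c (fun i => v i • (l + l')) = c (fun i => v i • l) + c (fun i => v i • l')
    rw [← map_add]
    simp only [smul_add]
    rfl
  map_smul' r l := Subtype.ext <| RDChar.ext' fun v => by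
    change c (fun i => v i • (r • l)) = c (fun i => (v i * r) • l)
    simp only [mul_smul]

theorem rdMk_apply {R : Type u} [Ring R] {m n : ℕ} (a : Fin m → Fin n → R)
    {L : Type u} [AddCommGroup L] [Module R L] (c : (Fin m → L) →+ AddCircle (1 : ℚ))
    (hc : ∀ y : Fin n → L, c (fun i => ∑ j, a i j • y j) = 0) (l : L) (v : Fin m → R) :
    (rdMk a c hc l).1 v = c (fun i => v i • l) := rfl

/-- The character of `K^m` attached to a map to the dual. -/
noncomputable def rdEv {R : Type u} [Ring R] {m n : ℕ} {a : Fin m → Fin n → R}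
    {K : Type u} [AddCommGroup K] [Module R K] (g : K →ₗ[R] rdDual a) :
    (Fin m → K) →+ AddCircle (1 : ℚ) where
  toFun k := ∑ i, (g (k i)).1 (Pi.single i 1)
  map_zero' := by simp [RDChar.zero_apply]
  map_add' k l := by simp [RDChar.add_apply, Finset.sum_add_distrib]

theorem rdEv_smul {R : Type u} [Ring R] {m n : ℕ} {a : Fin m → Fin n → R}
    {K : Type u} [AddCommGroup K] [Module R K] (g : K →ₗ[R] rdDual a) (k : K) (v : Fin m → R) :
    rdEv g (fun i => v i • k) = (g k).1 v := by
  change ∑ i, (g (v i • k)).1 (Pi.single i 1) = _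
  have h : ∀ i, (g (v i • k)).1 (Pi.single i 1) = (g k).1 (Pi.single i (v i)) := by
    intro i
    rw [map_smul]
    change (g k).1 (fun i' => (Pi.single i 1 : Fin m → R) i' * v i) = _
    congr 1
    ext i'
    by_cases hi : i' = i
    · subst hi; simp
    · simp [hi]
  simp only [h]
  rw [← map_sum, Finset.univ_sum_single]

theorem rdEv_image {R : Type u} [Ring R] {m n : ℕ} {a : Fin m → Fin n → R}
    {K : Type u} [AddCommGroup K] [Module R K] (g : K →ₗ[R] rdDual a) (y : Fin n → K) :
    rdEv g (fun i => ∑ j, a i j • y j) = 0 := by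
  have h : (fun i => ∑ j, a i j • y j) = ∑ j, (fun i => a i j • y j) := by
    ext i; simp
  rw [h, map_sum]
  refine Finset.sum_eq_zero fun j _ => ?_
  rw [rdEv_smul g (y j) (fun i => a i j), ← (g (y j)).2 (Pi.single j 1)]
  congr 1
  ext i
  simp [Pi.single_apply]

theorem rdEv_mk {R : Type u} [Ring R] {m n : ℕ} (a : Fin m → Fin n → R)
    {L : Type u} [AddCommGroup L] [Module R L] (c : (Fin m → L) →+ AddCircle (1 : ℚ))
    (hc : ∀ y : Fin n → L, c (fun i => ∑ j, a i j • y j) = 0) (k : Fin m → L) :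
    rdEv (rdMk a c hc) k = c k := by
  change ∑ i, c (fun i' => (Pi.single i 1 : Fin m → R) i' • k i) = _
  rw [← map_sum]
  congr 1
  ext i
  simp [Pi.single_apply]

/-- The subgroup of solvable right hand sides. -/
def rdImage {R : Type u} [Ring R] {m n : ℕ} (a : Fin m → Fin n → R)
    (L : Type u) [AddCommGroup L] [Module R L] : AddSubgroup (Fin m → L) where
  carrier := {k | ∃ y : Fin n → L, ∀ i, (∑ j, a i j • y j) = k i}
  zero_mem' := ⟨0, by simp⟩
  add_mem' := by
    rintro k l ⟨y, hy⟩ ⟨z, hz⟩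
    exact ⟨y + z, fun i => by simp [smul_add, Finset.sum_add_distrib, hy, hz]⟩
  neg_mem' := by
    rintro k ⟨y, hy⟩
    exact ⟨-y, fun i => by simp [hy]⟩

theorem rd_extend {G H : Type u} [AddCommGroup G] [AddCommGroup H]
    (i : G →+ H) (S : AddSubgroup H) (c : G →+ AddCircle (1 : ℚ))
    (hc : ∀ g, i g ∈ S → c g = 0) :
    ∃ d : H →+ AddCircle (1 : ℚ), (∀ g, d (i g) = c g) ∧ ∀ s ∈ S, d s = 0 := by
  let p : G →+ H ⧸ S := (QuotientAddGroup.mk' S).comp i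
  have hp : p.ker ≤ c.ker := fun g hg => hc g ((QuotientAddGroup.eq_zero_iff _).1 hg)
  obtain ⟨d, hd⟩ := CharacterModule.dual_surjective_of_injective (R := ℤ)
    (QuotientAddGroup.kerLift p).toIntLinearMap (QuotientAddGroup.kerLift_injective p)
    (QuotientAddGroup.lift p.ker c hp : G ⧸ p.ker →+ AddCircle (1 : ℚ))
  refine ⟨AddMonoidHom.comp (d : H ⧸ S →+ AddCircle (1 : ℚ)) (QuotientAddGroup.mk' S), fun g => ?_,
    fun s hs => ?_⟩
  · exact DFunLike.congr_fun hd (QuotientAddGroup.mk g)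
  · change d (QuotientAddGroup.mk s) = 0
    rw [(QuotientAddGroup.eq_zero_iff s).2 hs, map_zero]

theorem rdDual_pureInjective {R : Type u} [Ring R] {m n : ℕ} (a : Fin m → Fin n → R) :
    PureInjectiveL R (rdDual a) := by
  intro K L _ _ _ _ f hf hpure g
  obtain ⟨d, hd, hS⟩ := rd_extend (f.toAddMonoidHom.compLeft (Fin m)) (rdImage a L) (rdEv g) (by
    rintro k ⟨x, hx⟩
    obtain ⟨y, hy⟩ := hpure m n a k ⟨x, hx⟩
    rw [← funext hy]
    exact rdEv_image g y)
  refine ⟨rdMk a d (fun y => hS _ ⟨y, fun _ => rfl⟩), ?_⟩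
  ext k : 1
  refine Subtype.ext (RDChar.ext' fun v => ?_)
  rw [LinearMap.comp_apply, rdMk_apply, ← rdEv_smul, ← hd]
  congr 1
  ext i
  simp

/-- Over a ring `R`, every left `R`-module is RD-coflat if and only if every
pure-injective left `R`-module is RD-injective. -/
theorem all_rdCoflat_iff_pureInjective_rdInjective (R : Type u) [Ring R] :
    (∀ (M : Type u) [AddCommGroup M] [Module R M], RDCoflatL R M) ↔
      (∀ (M : Type u) [AddCommGroup M] [Module R M],
        PureInjectiveL R M → RDInjectiveL R M) := by
  constructor
  · intro h M _ _ hM K L _ _ _ _ f hf hrd g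
    exact hM K L f hf (h K L f hf hrd) g
  · intro h M _ _ P _ _ f hf hrd m n a k hx
    obtain ⟨x, hx⟩ := hx
    by_contra hk
    have hne : (QuotientAddGroup.mk k : (Fin m → M) ⧸ rdImage a M) ≠ 0 := fun h0 =>
      hk ((QuotientAddGroup.eq_zero_iff k).1 h0)
    obtain ⟨c, hc⟩ := CharacterModule.exists_character_apply_ne_zero_of_ne_zero hne
    let d : (Fin m → M) →+ AddCircle (1 : ℚ) := AddMonoidHom.comp
      (c : (Fin m → M) ⧸ rdImage a M →+ AddCircle (1 : ℚ)) (QuotientAddGroup.mk' (rdImage a M))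
    have hd : ∀ y : Fin n → M, d (fun i => ∑ j, a i j • y j) = 0 := fun y => by
      change c (QuotientAddGroup.mk _) = 0
      have hy : (fun i => ∑ j, a i j • y j) ∈ rdImage a M := ⟨y, fun _ => rfl⟩
      rw [(QuotientAddGroup.eq_zero_iff _).2 hy, map_zero]
    obtain ⟨e, he⟩ := h (rdDual a) (rdDual_pureInjective a) M P f hf hrd (rdMk a d hd)
    apply hc
    change d k = 0
    rw [← rdEv_mk a d hd k, ← he, ← rdEv_image e x, funext hx]
    rfl
end

section
/- Let R be a ring in which each direct sum of RD-injective right modules is RD-injective. Then R is right artinian. -/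
universe u

open MulOpposite

/-- Descending chain condition on principal left ideals. -/
def DCCL (A : Type u) [Ring A] : Prop :=
  ∀ b : ℕ → A, (∀ n, ∃ a, b (n + 1) = a * b n) → ∃ n x, b n = x * b (n + 1)

lemma DCCL.of_surjective {A B : Type u} [Ring A] [Ring B] (f : A →+* B)
    (hf : Function.Surjective f) (hA : DCCL A) : DCCL B := by
  intro b hb
  choose a ha using hb
  choose s hs using hf
  let c : ℕ → A := fun n => Nat.rec (s (b 0)) (fun n x => s (a n) * x) n
  have hc : ∀ n, f (c n) = b n := by
    intro n
    induction n with
    | zero => exact hs _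
    | succ n ih =>
      have : c (n + 1) = s (a n) * c n := rfl
      rw [this, map_mul, ih, hs, ha]
  obtain ⟨n, x, hx⟩ := hA c (fun n => ⟨s (a n), rfl⟩)
  refine ⟨n, f x, ?_⟩
  rw [← hc n, ← hc (n + 1), ← map_mul, ← hx]

lemma DCCL.wf {A : Type u} [Ring A] (hA : DCCL A) :
    WellFounded (fun x y : A => Ideal.span {x} < Ideal.span {y}) := by
  rw [wellFounded_iff_isEmpty_descending_chain]
  refine ⟨fun ⟨b, hb⟩ => ?_⟩
  obtain ⟨n, x, hx⟩ := hA b (fun n => by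
    have : b (n + 1) ∈ Ideal.span {b n} := (hb n).le (Ideal.mem_span_singleton_self _)
    obtain ⟨a, ha⟩ := Ideal.mem_span_singleton'.1 this
    exact ⟨a, ha.symm⟩)
  refine (hb n).not_ge ?_
  rw [Ideal.span_singleton_le_iff_mem]
  exact Ideal.mem_span_singleton'.2 ⟨x, hx.symm⟩

lemma DCCL.exists_simple {A : Type u} [Ring A] (hA : DCCL A) (g : A) (hg : g ≠ 0) :
    ∃ x : A, x ≠ 0 ∧ x ∈ Ideal.span {g} ∧ ∀ N : Ideal A, N ≤ Ideal.span {x} → N ≠ ⊥ →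
      N = Ideal.span {x} := by
  obtain ⟨x, ⟨hx0, hxg⟩, hmin⟩ := hA.wf.has_min {x | x ≠ 0 ∧ x ∈ Ideal.span {g}}
    ⟨g, hg, Ideal.mem_span_singleton_self _⟩
  refine ⟨x, hx0, hxg, fun N hN hN0 => le_antisymm hN ?_⟩
  obtain ⟨y, hyN, hy0⟩ := Submodule.exists_mem_ne_zero_of_ne_bot hN0
  have hyx : Ideal.span {y} ≤ Ideal.span {x} := by
    rw [Ideal.span_singleton_le_iff_mem]; exact hN hyN
  have h1 := hmin y ⟨hy0, (Ideal.span_singleton_le_iff_mem _).2 hxg (hN hyN)⟩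
  have h2 : Ideal.span {y} = Ideal.span {x} := by
    by_contra hne
    exact h1 (lt_of_le_of_ne hyx hne)
  rw [← h2, Ideal.span_singleton_le_iff_mem]
  exact hyN

lemma DCCL.isSemisimpleRing {A : Type u} [Ring A] (hA : DCCL A)
    (hJ : Ring.jacobson A = ⊥) : IsSemisimpleRing A := by
  apply IsSemisimpleModule.of_sSup_simples_eq_top
  set S : Ideal A := sSup {m : Submodule A A | IsSimpleModule A m} with hS
  obtain ⟨g, ⟨hgg, hgS⟩, hmin⟩ := hA.wf.has_min {g | g * g = g ∧ Ideal.span {g} ⊔ S = ⊤}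
    ⟨1, by simp [Ideal.span_singleton_one]⟩
  by_cases hg : g = 0
  · simpa [hg] using hgS
  exfalso
  obtain ⟨x, hx0, hxg, hxs⟩ := hA.exists_simple g hg
  have hxJ : x ∉ Ring.jacobson A := by simpa [hJ] using hx0
  rw [Ring.jacobson_eq_sInf_isMaximal, Submodule.mem_sInf] at hxJ
  push Not at hxJ
  obtain ⟨M, hM, hxM⟩ := hxJ
  have hinf : Ideal.span {x} ⊓ M = ⊥ := by
    by_contra hne
    have := hxs _ inf_le_left hne
    exact hxM ((inf_eq_left.1 this) (Ideal.mem_span_singleton_self _))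
  have hsup : Ideal.span {x} ⊔ M = ⊤ := by
    have hM' : IsCoatom M := Ideal.isMaximal_def.1 hM
    refine hM'.2 _ (lt_of_le_of_ne le_sup_right fun h => hxM ?_)
    rw [h]
    exact (le_sup_left : Ideal.span {x} ≤ _) (Ideal.mem_span_singleton_self _)
  have hxS : Ideal.span {x} ≤ S := by
    apply le_sSup
    change IsSimpleModule A (Ideal.span {x})
    rw [isSimpleModule_iff_isAtom]
    refine ⟨by simpa using hx0, fun N hN => ?_⟩
    by_contra hne
    exact hN.ne (hxs N hN.le hne)
  obtain ⟨u, hu, m, hm, hum⟩ := Submodule.mem_sup.1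
    (show g ∈ Ideal.span {x} ⊔ M from hsup ▸ Submodule.mem_top)
  have hxg' : Ideal.span {x} ≤ Ideal.span {g} := (Ideal.span_singleton_le_iff_mem _).2 hxg
  have hmg : m ∈ Ideal.span {g} := by
    have : m = g - u := by rw [← hum]; abel
    rw [this]
    exact Submodule.sub_mem _ (Ideal.mem_span_singleton_self _) (hxg' hu)
  have key : ∀ y ∈ Ideal.span {g}, y ∈ M → y = y * m := by
    intro y hy hyM
    obtain ⟨c, rfl⟩ := Ideal.mem_span_singleton'.1 hy
    have h1 : c * g * u = c * g - c * g * m := by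
      have : c * g * u + c * g * m = c * g := by
        rw [← mul_add, hum, mul_assoc, hgg]
      rw [← this]; abel_nf; rw [this]; abel
    have h2 : c * g * u ∈ Ideal.span {x} ⊓ M := by
      refine ⟨Ideal.mul_mem_left _ _ hu, ?_⟩
      rw [SetLike.mem_coe, h1]
      exact Submodule.sub_mem _ hyM (Ideal.mul_mem_left _ _ hm)
    rw [hinf, Submodule.mem_bot, h1] at h2
    exact sub_eq_zero.1 h2
  refine hmin m ⟨(key m hmg hm).symm, ?_⟩ ?_
  · rw [eq_top_iff, ← hgS]
    refine sup_le ?_ le_sup_right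
    rw [Ideal.span_singleton_le_iff_mem, ← hum, add_comm]
    exact Submodule.add_mem_sup (Ideal.mem_span_singleton_self _) (hxS hu)
  · refine lt_of_le_of_ne ((Ideal.span_singleton_le_iff_mem _).2 hmg) fun h => hxM ?_
    exact (Ideal.span_singleton_le_iff_mem _).2 hm (h ▸ hxg)

lemma DCCL.eq_zero {A : Type u} [Ring A] (hA : DCCL A) (b a : ℕ → A)
    (ha : ∀ n, a n ∈ Ring.jacobson A) (hb : ∀ n, b (n + 1) = a n * b n) : ∃ n, b n = 0 := by
  obtain ⟨n, x, hx⟩ := hA b (fun n => ⟨a n, hb n⟩)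
  refine ⟨n, ?_⟩
  have h1 : a n ∈ Ideal.jacobson (⊥ : Ideal A) := by
    rw [Ideal.jacobson_bot]; exact ha n
  obtain ⟨z, hz⟩ := Ideal.mem_jacobson_iff.1 h1 (-x)
  rw [Submodule.mem_bot] at hz
  have h2 : z * (b n - x * a n * b n) = b n := by
    have : z * (b n - x * a n * b n) = (z * -x * a n + z - 1) * b n + b n := by noncomm_ring
    rw [this, hz]; simp
  rw [← h2, mul_assoc, ← hb, ← hx]; simp

lemma isArtinian_of_DCCL {R : Type u} [Ring R] (hR : DCCL R) (hN : IsNoetherianRing Rᵐᵒᵖ) :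
    IsArtinianRing Rᵐᵒᵖ := by
  have hss : IsSemisimpleRing (R ⧸ Ring.jacobson R) :=
    (hR.of_surjective (Ideal.Quotient.mk (Ring.jacobson R))
      Ideal.Quotient.mk_surjective).isSemisimpleRing (Ring.jacobson_quotient_jacobson R)
  let φ : Rᵐᵒᵖ →+* (R ⧸ Ring.jacobson R)ᵐᵒᵖ := (Ideal.Quotient.mk (Ring.jacobson R)).op
  have hφ : Function.Surjective φ := by
    intro y
    obtain ⟨x, hx⟩ := Ideal.Quotient.mk_surjective y.unop
    exact ⟨op x, by simp [φ, hx]⟩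
  have hker : ∀ x, x ∈ RingHom.ker φ ↔ x.unop ∈ Ring.jacobson R := by
    intro x
    rw [RingHom.mem_ker, ← Ideal.Quotient.eq_zero_iff_mem]
    simp [φ]
  have hle : Ring.jacobson Rᵐᵒᵖ ≤ RingHom.ker φ := by
    have : RingHomSurjective φ := ⟨hφ⟩
    have := Ring.le_comap_jacobson φ
    have h0 : Ring.jacobson (R ⧸ Ring.jacobson R)ᵐᵒᵖ = ⊥ := IsSemisimpleModule.jacobson_eq_bot _ _
    rwa [h0] at this
  have hge : RingHom.ker φ ≤ Ring.jacobson Rᵐᵒᵖ := by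
    refine le_of_le_of_eq ?_ (Ring.jacobson_eq_sInf_isMaximal Rᵐᵒᵖ).symm
    refine le_sInf fun M (hM : M.IsMaximal) => ?_
    by_contra hn
    have hM' : IsCoatom M := hM.out
    have hsup : M ⊔ RingHom.ker φ = ⊤ := hM'.2 _ (left_lt_sup.2 hn)
    obtain ⟨t, ht, i, hi, hti⟩ := Submodule.mem_sup.1
      (show (1 : Rᵐᵒᵖ) ∈ M ⊔ RingHom.ker φ from hsup ▸ Submodule.mem_top)
    obtain ⟨n, hn⟩ := hR.eq_zero (fun n => i.unop ^ n) (fun _ => i.unop)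
      (fun _ => (hker _).1 hi) (fun n => pow_succ' _ _)
    have hnil : IsNilpotent i := ⟨n, by simpa using congrArg op hn⟩
    have hu : IsUnit t := by
      rw [show t = 1 - i by rw [← hti]; abel]
      exact hnil.isUnit_one_sub
    exact hM'.1 (Ideal.eq_top_of_isUnit_mem _ ht hu)
  have heq := le_antisymm hle hge
  have h1 : IsSemisimpleRing (Rᵐᵒᵖ ⧸ Ring.jacobson Rᵐᵒᵖ) :=
    ((Ideal.quotEquivOfEq heq).trans
      (RingHom.quotientKerEquivOfSurjective hφ)).symm.isSemisimpleRing
  have h2 : IsNilpotent (Ring.jacobson Rᵐᵒᵖ) := by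
    set J := Ring.jacobson Rᵐᵒᵖ with hJ
    obtain ⟨n, hn⟩ := monotone_stabilizes_iff_noetherian.2 hN
      ⟨fun n => Submodule.annihilator (J ^ n), monotone_nat_of_le_succ fun n =>
        Submodule.annihilator_mono (Ideal.pow_le_pow_right n.le_succ)⟩
    have hn' : Submodule.annihilator (J ^ n) = Submodule.annihilator (J ^ (n + 1)) :=
      hn (n + 1) n.le_succ
    refine ⟨n, ?_⟩
    by_contra hne
    have step : ∀ x : {x // x ∉ Submodule.annihilator (J ^ n)},
        ∃ a : J, x.1 * a.1 ∉ Submodule.annihilator (J ^ n) := by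
      rintro ⟨x, hx⟩
      by_contra! hcon
      apply hx
      rw [hn', Submodule.mem_annihilator]
      intro y hy
      rw [Ideal.IsTwoSided.pow_succ] at hy
      refine Submodule.mul_induction_on hy (fun a ha c hc => ?_) (fun a c ha hc => ?_)
      · have := Submodule.mem_annihilator.1 (hcon ⟨a, ha⟩) c hc
        simpa [mul_assoc] using this
      · rw [smul_add, ha, hc, add_zero]
    choose a ha using step
    have h10 : (1 : Rᵐᵒᵖ) ∉ Submodule.annihilator (J ^ n) := by
      intro h
      apply hne
      change J ^ n = ⊥
      rw [eq_bot_iff]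
      intro y hy
      simpa using Submodule.mem_annihilator.1 h y hy
    let b : ℕ → {x // x ∉ Submodule.annihilator (J ^ n)} :=
      fun k => Nat.rec ⟨1, h10⟩ (fun _ x => ⟨x.1 * (a x).1, ha x⟩) k
    have hb : ∀ k, (b (k + 1)).1 = (b k).1 * (a (b k)).1 := fun k => rfl
    obtain ⟨k, hk⟩ := hR.eq_zero (fun k => (b k).1.unop) (fun k => (a (b k)).1.unop)
      (fun k => (hker _).1 (hle (a (b k)).2)) (fun k => by simp [hb])
    apply (b k).2
    have : (b k).1 = 0 := by simpa using congrArg op hk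
    rw [this]; exact Submodule.zero_mem _
  have : IsSemiprimaryRing Rᵐᵒᵖ := ⟨h1, h2⟩
  exact IsSemiprimaryRing.isNoetherian_iff_isArtinian.1 hN

/-- The character group of the left module `R / R r`. -/
def CMod (R : Type u) [Ring R] (r : R) : AddSubgroup (R →+ AddCircle (1 : ℚ)) where
  carrier := {φ | ∀ t, φ (t * r) = 0}
  zero_mem' := fun _ => rfl
  add_mem' := fun {a b} ha hb t => by
    rw [AddMonoidHom.add_apply, ha t, hb t, add_zero]
  neg_mem' := fun {a} ha t => by
    rw [AddMonoidHom.neg_apply, ha t, neg_zero]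

/-- The action of `R` on characters. -/
def CMod.act {R : Type u} [Ring R] {r : R} (s : R) (φ : CMod R r) : CMod R r :=
  ⟨φ.1.comp (AddMonoidHom.mulLeft s), fun t => by
    have := φ.2 (s * t)
    simpa [mul_assoc] using this⟩

lemma CMod.act_apply {R : Type u} [Ring R] {r : R} (s : R) (φ : CMod R r) (t : R) :
    (CMod.act s φ).1 t = φ.1 (s * t) := rfl

lemma CMod.ext {R : Type u} [Ring R] {r : R} {φ ψ : CMod R r}
    (h : ∀ t, φ.1 t = ψ.1 t) : φ = ψ :=
  Subtype.ext (AddMonoidHom.ext h)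

instance CMod.instModule {R : Type u} [Ring R] (r : R) : Module Rᵐᵒᵖ (CMod R r) where
  smul s φ := CMod.act s.unop φ
  one_smul φ := CMod.ext fun t => by
    change φ.1 (1 * t) = _
    rw [one_mul]
  mul_smul x y φ := CMod.ext fun t => by
    change φ.1 (y.unop * x.unop * t) = φ.1 (y.unop * (x.unop * t))
    rw [mul_assoc]
  smul_zero x := CMod.ext fun t => rfl
  smul_add x φ ψ := CMod.ext fun t => rfl
  add_smul x y φ := CMod.ext fun t => by
    change φ.1 ((x.unop + y.unop) * t) = φ.1 (x.unop * t) + φ.1 (y.unop * t)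
    rw [add_mul, map_add]
  zero_smul φ := CMod.ext fun t => by
    change φ.1 (0 * t) = 0
    rw [zero_mul, map_zero]

lemma CMod.smul_apply {R : Type u} [Ring R] {r : R} (s : R) (φ : CMod R r) (t : R) :
    (op s • φ).1 t = φ.1 (s * t) := rfl

/-- Extension of characters along `K / K' → L / L'`. -/
lemma exists_char_ext {K L : Type u} [AddCommGroup K] [AddCommGroup L] (f : K →+ L)
    (L' : AddSubgroup L) (g : K →+ AddCircle (1 : ℚ)) (hg : ∀ k, f k ∈ L' → g k = 0) :
    ∃ h : L →+ AddCircle (1 : ℚ), (∀ k, h (f k) = g k) ∧ ∀ y ∈ L', h y = 0 := by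
  let q : K →+ L ⧸ L' := (QuotientAddGroup.mk' L').comp f
  have hq : ∀ k, q k = 0 ↔ f k ∈ L' := fun k => QuotientAddGroup.eq_zero_iff (f k)
  let i : (K ⧸ q.ker) →+ L ⧸ L' := QuotientAddGroup.kerLift q
  have hi : Function.Injective i := QuotientAddGroup.kerLift_injective q
  let g' : (K ⧸ q.ker) →+ AddCircle (1 : ℚ) := QuotientAddGroup.lift q.ker g
    (fun k hk => hg k ((hq k).1 hk))
  obtain ⟨h', hh'⟩ := CharacterModule.dual_surjective_of_injective i.toIntLinearMap hi
    (show CharacterModule (K ⧸ q.ker) from g')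
  let h'' : (L ⧸ L') →+ AddCircle (1 : ℚ) := h'
  refine ⟨h''.comp (QuotientAddGroup.mk' L'), fun k => ?_, fun y hy => ?_⟩
  · have := DFunLike.congr_fun hh' (QuotientAddGroup.mk k)
    exact this
  · have : QuotientAddGroup.mk' L' y = 0 := (QuotientAddGroup.eq_zero_iff y).2 hy
    rw [AddMonoidHom.comp_apply, this, map_zero]

lemma CMod.rdInjective {R : Type u} [Ring R] (r : R) : RDInjective R (CMod R r) := by
  intro K L _ _ _ _ f hf hrd g
  let g0 : K →+ AddCircle (1 : ℚ) :=
    ((AddMonoidHom.eval (1 : R)).comp (CMod R r).subtype).comp g.toAddMonoidHom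
  have hg0 : ∀ k, g0 k = (g k).1 1 := fun k => rfl
  let L' : AddSubgroup L := (DistribSMul.toAddMonoidHom L (op r)).range
  obtain ⟨h0, h1, h2⟩ := exists_char_ext f.toAddMonoidHom L' g0 (fun k hk => by
    obtain ⟨y, hy⟩ := hk
    obtain ⟨k', rfl⟩ := hrd r k y hy.symm
    rw [hg0, map_smul, CMod.smul_apply, mul_one]
    have := (g k').2 1
    rwa [one_mul] at this)
  have h2' : ∀ y : L, h0 (op r • y) = 0 := fun y => h2 _ ⟨y, rfl⟩
  have h1' : ∀ k : K, h0 (f k) = (g k).1 1 := h1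
  let H : L → CMod R r := fun y => ⟨
    { toFun := fun s => h0 (op s • y)
      map_zero' := by simp
      map_add' := fun a b => by simp [add_smul] }, fun t => by
        change h0 (op (t * r) • y) = 0
        rw [op_mul, mul_smul, h2']⟩
  have hH : ∀ y s, (H y).1 s = h0 (op s • y) := fun _ _ => rfl
  refine ⟨{ toFun := H
            map_add' := fun x y => CMod.ext fun t => ?_
            map_smul' := fun c y => CMod.ext fun t => ?_ }, LinearMap.ext fun k => CMod.ext fun t => ?_⟩
  · change (H (x + y)).1 t = (H x).1 t + (H y).1 t
    simp [hH]
  · change (H (c • y)).1 t = (H y).1 (c.unop * t)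
    simp [hH, mul_smul]
  · change (H (f k)).1 t = _
    rw [hH, ← map_smul, h1', map_smul, CMod.smul_apply, mul_one]

lemma exists_retract {R : Type u} [Ring R]
    (h : ∀ (ι : Type u) (M : ι → Type u) [∀ i, AddCommGroup (M i)]
      [∀ i, Module Rᵐᵒᵖ (M i)],
      (∀ i, RDInjective R (M i)) → RDInjective R (Π₀ i, M i))
    (r : ℕ → R) :
    ∃ π : (∀ i : ULift.{u} ℕ, CMod R (r i.down)) →ₗ[Rᵐᵒᵖ] Π₀ i : ULift.{u} ℕ, CMod R (r i.down),
      ∀ k : Π₀ i : ULift.{u} ℕ, CMod R (r i.down), π (fun i => k i) = k := by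
  classical
  let f : (Π₀ i : ULift.{u} ℕ, CMod R (r i.down)) →ₗ[Rᵐᵒᵖ]
      (∀ i : ULift.{u} ℕ, CMod R (r i.down)) :=
    { toFun := fun k i => k i
      map_add' := fun _ _ => rfl
      map_smul' := fun _ _ => rfl }
  obtain ⟨π, hπ⟩ := h (ULift.{u} ℕ) (fun i => CMod R (r i.down))
    (fun i => CMod.rdInjective _) _ _ f (fun a b hab => DFinsupp.ext fun i => congrFun hab i)
    (fun s k y hky => by
      refine ⟨DFinsupp.mk k.support (fun i => y i), DFinsupp.ext fun i => ?_⟩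
      rw [DFinsupp.smul_apply, DFinsupp.mk_apply]
      split_ifs with hi
      · exact congrFun hky i
      · rw [smul_zero]; simpa using hi) LinearMap.id
  exact ⟨π, fun k => LinearMap.congr_fun hπ k⟩

lemma dccl_of_sum {R : Type u} [Ring R]
    (h : ∀ (ι : Type u) (M : ι → Type u) [∀ i, AddCommGroup (M i)]
      [∀ i, Module Rᵐᵒᵖ (M i)],
      (∀ i, RDInjective R (M i)) → RDInjective R (Π₀ i, M i)) : DCCL R := by
  classical
  intro b hb
  by_contra! hcon
  have hχ : ∀ n, ∃ c : CMod R (b (n + 1)), c.1 (b n) ≠ 0 := by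
    intro n
    have hne : (Submodule.Quotient.mk (b n) : R ⧸ Ideal.span {b (n + 1)}) ≠ 0 := by
      rw [Ne, Submodule.Quotient.mk_eq_zero]
      intro hmem
      obtain ⟨x, hx⟩ := Ideal.mem_span_singleton'.1 hmem
      exact hcon n x hx.symm
    obtain ⟨c, hc⟩ := CharacterModule.exists_character_apply_ne_zero_of_ne_zero hne
    let c' : (R ⧸ Ideal.span {b (n + 1)}) →+ AddCircle (1 : ℚ) := c
    refine ⟨⟨c'.comp (Submodule.mkQ (Ideal.span {b (n + 1)})).toAddMonoidHom, fun t => ?_⟩, hc⟩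
    have : Submodule.mkQ (Ideal.span {b (n + 1)}) (t * b (n + 1)) = 0 := by
      rw [Submodule.mkQ_apply, Submodule.Quotient.mk_eq_zero]
      exact Ideal.mem_span_singleton'.2 ⟨t, rfl⟩
    change c' (Submodule.mkQ (Ideal.span {b (n + 1)}) (t * b (n + 1))) = 0
    rw [this, map_zero]
  choose c hc using hχ
  obtain ⟨π, hπ⟩ := exists_retract h (fun n => b (n + 1))
  have hd : ∀ N n, N ≤ n → ∃ d, b n = d * b N := by
    intro N n hn
    induction n, hn using Nat.le_induction with
    | base => exact ⟨1, (one_mul _).symm⟩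
    | succ n hn ih =>
      obtain ⟨d, hd⟩ := ih
      obtain ⟨a, ha⟩ := hb n
      exact ⟨a * d, by rw [ha, hd, mul_assoc]⟩
  let x : ∀ i : ULift.{u} ℕ, CMod R (b (i.down + 1)) := fun i => op (b i.down) • c i.down
  obtain ⟨⟨N⟩, hN⟩ := Infinite.exists_notMem_finset (π x).support
  have hN0 : (π x) ⟨N⟩ = 0 := by simpa using hN
  let hd0 : Π₀ i : ULift.{u} ℕ, CMod R (b (i.down + 1)) :=
    DFinsupp.mk ((Finset.range (N + 1)).image ULift.up) (fun i => x i)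
  choose d hd using hd (N + 1)
  let y : ∀ i : ULift.{u} ℕ, CMod R (b (i.down + 1)) := fun i =>
    if hi : N + 1 ≤ i.down then op (d i.down hi) • c i.down else 0
  have hx : x = (fun i => hd0 i) + op (b (N + 1)) • y := by
    funext i
    rw [Pi.add_apply, Pi.smul_apply]
    by_cases hi : N + 1 ≤ i.down
    · have h1 : hd0 i = 0 := by
        apply DFinsupp.mk_of_notMem
        simp only [Finset.mem_image, Finset.mem_range, not_exists, not_and]
        rintro j hj rfl
        exact absurd hi (by simpa using hj)
      have h2 : y i = op (d i.down hi) • c i.down := dif_pos hi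
      rw [h1, h2, zero_add, ← mul_smul, ← op_mul, ← hd]
    · have h1 : hd0 i = x i := by
        apply DFinsupp.mk_of_mem
        simp only [Finset.mem_image, Finset.mem_range]
        exact ⟨i.down, by omega, rfl⟩
      have h2 : y i = 0 := dif_neg hi
      rw [h1, h2, smul_zero, add_zero]
  have h3 : (π x) ⟨N⟩ = x ⟨N⟩ + op (b (N + 1)) • (π y) ⟨N⟩ := by
    rw [hx, map_add, map_smul, hπ, DFinsupp.add_apply, DFinsupp.smul_apply, ← hx]
    congr 1
    apply DFinsupp.mk_of_mem
    simp
  rw [hN0] at h3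
  have h4 := congrArg (fun φ : CMod R (b (N + 1)) => φ.1 1) h3
  have h5 : (0 : AddCircle (1 : ℚ)) = (c N).1 (b N * 1) + ((π y) ⟨N⟩).1 (b (N + 1) * 1) := h4
  have h6 := ((π y) ⟨N⟩).2 1
  simp only [one_mul] at h6
  rw [mul_one, mul_one, h6, add_zero] at h5
  exact hc N h5.symm

lemma noetherian_of_sum {R : Type u} [Ring R]
    (h : ∀ (ι : Type u) (M : ι → Type u) [∀ i, AddCommGroup (M i)]
      [∀ i, Module Rᵐᵒᵖ (M i)],
      (∀ i, RDInjective R (M i)) → RDInjective R (Π₀ i, M i)) : IsNoetherian Rᵐᵒᵖ R := by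
  classical
  rw [← monotone_stabilizes_iff_noetherian]
  intro I
  by_contra! hcon
  have hχ : ∀ n, ∃ a : R, (∃ m, a ∈ I m) ∧ ∃ c : CMod R (0 : R), (∀ s ∈ I n, c.1 s = 0) ∧ c.1 a ≠ 0 := by
    intro n
    obtain ⟨m, hnm, hne⟩ := hcon n
    obtain ⟨a, ham, han⟩ := SetLike.exists_of_lt (lt_of_le_of_ne (I.mono hnm) hne)
    have hne : (Submodule.Quotient.mk a : R ⧸ I n) ≠ 0 := by
      rwa [Ne, Submodule.Quotient.mk_eq_zero]
    obtain ⟨c, hc⟩ := CharacterModule.exists_character_apply_ne_zero_of_ne_zero hne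
    let c' : (R ⧸ I n) →+ AddCircle (1 : ℚ) := c
    refine ⟨a, ⟨m, ham⟩, ⟨c'.comp (Submodule.mkQ (I n)).toAddMonoidHom, fun t => ?_⟩, ?_, hc⟩
    · rw [mul_zero, map_zero]
    · intro s hs
      change c' (Submodule.mkQ (I n) s) = 0
      rw [show Submodule.mkQ (I n) s = 0 by simpa using hs, map_zero]
  choose a ham c hcI hca using hχ
  obtain ⟨π, hπ⟩ := exists_retract h (fun _ => (0 : R))
  let e : ∀ i : ULift.{u} ℕ, CMod R (0 : R) := fun i => c i.down
  obtain ⟨⟨n⟩, hn⟩ := Infinite.exists_notMem_finset (π e).support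
  have hn0 : (π e) ⟨n⟩ = 0 := by simpa using hn
  obtain ⟨N, hN⟩ := ham n
  let k : Π₀ i : ULift.{u} ℕ, CMod R (0 : R) :=
    DFinsupp.mk ((Finset.range N).image ULift.up) (fun i => op (a n) • e i)
  have hk : (fun i => k i) = op (a n) • e := by
    funext i
    by_cases hi : i.down < N
    · apply DFinsupp.mk_of_mem
      simp only [Finset.mem_image, Finset.mem_range]
      exact ⟨i.down, hi, rfl⟩
    · have h1 : k i = 0 := by
        apply DFinsupp.mk_of_notMem
        simp only [Finset.mem_image, Finset.mem_range, not_exists, not_and]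
        rintro j hj rfl
        exact hi hj
      rw [h1]
      refine CMod.ext fun t => ?_
      change 0 = (c i.down).1 (a n * t)
      rw [hcI]
      have : op t • a n ∈ I i.down := Submodule.smul_mem _ _ (I.mono (not_lt.1 hi) hN)
      simpa using this
  have h1 := hπ k
  rw [hk, map_smul] at h1
  have h2 := DFunLike.congr_fun h1 ⟨n⟩
  rw [DFinsupp.smul_apply, hn0, smul_zero] at h2
  have h3 : k ⟨n⟩ = op (a n) • c n := congrFun hk ⟨n⟩
  rw [h3] at h2
  have h4 : (0 : AddCircle (1 : ℚ)) = (c n).1 (a n * 1) :=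
    congrArg (fun φ : CMod R (0 : R) => φ.1 1) h2
  rw [mul_one] at h4
  exact hca n h4.symm

/-- `R` and `Rᵐᵒᵖ` are isomorphic as right `R`-modules. -/
def opEquivRight (R : Type u) [Ring R] : R ≃ₗ[Rᵐᵒᵖ] Rᵐᵒᵖ :=
  { opAddEquiv with
    map_smul' := fun c x => by simp }


/-- If each direct sum of RD-injective right `R`-modules is RD-injective, then `R` is
right artinian. -/
theorem rightArtinian_of_directSum_rdInjective (R : Type u) [Ring R]
    (h : ∀ (ι : Type u) (M : ι → Type u) [∀ i, AddCommGroup (M i)]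
      [∀ i, Module Rᵐᵒᵖ (M i)],
      (∀ i, RDInjective R (M i)) → RDInjective R (Π₀ i, M i)) :
    IsArtinian Rᵐᵒᵖ R := by
  have hN := noetherian_of_sum h
  have hN' : IsNoetherianRing Rᵐᵒᵖ := (opEquivRight R).isNoetherian_iff.1 hN
  exact (opEquivRight R).isArtinian_iff.2 (isArtinian_of_DCCL (dccl_of_sum h) hN')
end

section
/- Let R be a commutative ring. R is a finite product of artinian valuation rings and finite rings if and only if every RD-coflat R-module is RD-injective. -/
universe u

open MulOpposite

section PartA

/-- Purity for arbitrary finite index types. -/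
theorem IsPureC.general {R : Type u} [CommRing R] {K L : Type u} [AddCommGroup K] [Module R K]
    [AddCommGroup L] [Module R L] {f : K →ₗ[R] L} (hf : IsPureC R f)
    {ι κ : Type} [Fintype ι] [Fintype κ] (a : ι → κ → R) (k : ι → K)
    (h : ∃ x : κ → L, ∀ i, (∑ j, a i j • x j) = f (k i)) :
    ∃ y : κ → K, ∀ i, (∑ j, a i j • y j) = k i := by
  obtain ⟨x, hx⟩ := h
  let e := Fintype.equivFin ι
  let e' := Fintype.equivFin κ
  obtain ⟨y, hy⟩ := hf (Fintype.card ι) (Fintype.card κ)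
    (fun i j => a (e.symm i) (e'.symm j)) (fun i => k (e.symm i))
    ⟨fun j => x (e'.symm j), fun i => by
      rw [← hx (e.symm i)]
      exact Equiv.sum_comp e'.symm (fun j => a (e.symm i) j • x j)⟩
  refine ⟨fun j => y (e' j), fun i => ?_⟩
  have := hy (e i)
  simp only [Equiv.symm_apply_apply] at this
  rw [← this, ← Equiv.sum_comp e']
  simp

/-- A linear relation between `L` and `M` preserving solvability of finite linear systems. -/
def GoodRel (R : Type u) [CommRing R] {L M : Type u} [AddCommGroup L] [Module R L]
    [AddCommGroup M] [Module R M] (G : Submodule R (L × M)) : Prop :=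
  ∀ (ι κ : Type) [Fintype ι] [Fintype κ] (a : ι → κ → R) (k : ι → L × M),
    (∀ i, k i ∈ G) → (∃ x : κ → L, ∀ i, (∑ j, a i j • x j) = (k i).1) →
    ∃ y : κ → M, ∀ i, (∑ j, a i j • y j) = (k i).2

/-- The subset of `M` defined by a finite homogeneous system with one distinguished variable. -/
def ppSet {R : Type u} [CommRing R] (M : Type u) [AddCommGroup M] [Module R M]
    {ι κ : Type} [Fintype κ] (a : ι → κ → R) (c : ι → R) : Set M :=
  {y | ∃ z : κ → M, ∀ i, (∑ j, a i j • z j) = c i • y}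

/-- The collection of all `ppSet`s. -/
def ppSets (R : Type u) [CommRing R] (M : Type u) [AddCommGroup M] [Module R M] : Set (Set M) :=
  {V | ∃ (ι κ : Type) (_ : Fintype ι) (_ : Fintype κ) (a : ι → κ → R) (c : ι → R),
    V = ppSet M a c}

theorem GoodRel.step {R : Type u} [CommRing R] {L M : Type u} [AddCommGroup L] [Module R L]
    [AddCommGroup M] [Module R M] {G : Submodule R (L × M)} (hG : GoodRel R G)
    (hfin : (ppSets R M).Finite) (x : L) :
    ∃ y : M, GoodRel R (G ⊔ Submodule.span R {(x, y)}) := by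
  -- solvable systems
  let T : Set (Set M) := {V | ∃ (ι κ : Type) (_ : Fintype ι) (_ : Fintype κ) (a : ι → κ → R)
    (c : ι → R) (g : ι → L × M), (∀ i, g i ∈ G) ∧
    (∃ z : κ → L, ∀ i, (∑ j, a i j • z j) = (g i).1 + c i • x) ∧ V = ppSet M a c}
  have hT : T.Finite := hfin.subset (by
    rintro V ⟨ι, κ, i1, i2, a, c, g, -, -, rfl⟩
    exact ⟨ι, κ, i1, i2, a, c, rfl⟩)
  have hne : T.Nonempty := ⟨_, Empty, Empty, inferInstance, inferInstance, fun i => i.elim,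
    fun i => i.elim, fun i => i.elim, fun i => i.elim, ⟨fun i => i.elim, fun i => i.elim⟩, rfl⟩
  -- solvable in `M` as well
  have key : ∀ (ι κ : Type) [Fintype ι] [Fintype κ] (a : ι → κ → R) (c : ι → R) (g : ι → L × M),
      (∀ i, g i ∈ G) → (∃ z : κ → L, ∀ i, (∑ j, a i j • z j) = (g i).1 + c i • x) →
      ∃ (y : M) (z : κ → M), ∀ i, (∑ j, a i j • z j) = (g i).2 + c i • y := by
    intro ι κ _ _ a c g hg ⟨z, hz⟩
    obtain ⟨w, hw⟩ := hG ι (Option κ) (fun i j => j.elim (- c i) (a i)) g hg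
      ⟨fun j => j.elim x z, fun i => by
        rw [Fintype.sum_option]
        simp [hz i]⟩
    refine ⟨w none, fun j => w (some j), fun i => ?_⟩
    rw [← hw i, Fintype.sum_option]
    simp
  obtain ⟨V, hVmin⟩ := hT.exists_minimal hne
  obtain ⟨ι, κ, i1, i2, a, c, g, hg, hz, hV⟩ := hVmin.prop
  obtain ⟨y0, z0, hy0⟩ := key ι κ a c g hg hz
  refine ⟨y0, ?_⟩
  intro ι' κ' _ _ a' k hk hx'
  have hk' : ∀ i, ∃ (g' : L × M) (c' : R), g' ∈ G ∧ k i = g' + c' • (x, y0) := by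
    intro i
    obtain ⟨p, hp, q, hq, hpq⟩ := Submodule.mem_sup.1 (hk i)
    obtain ⟨c', rfl⟩ := Submodule.mem_span_singleton.1 hq
    exact ⟨p, c', hp, hpq.symm⟩
  choose g' c' hg' hkg using hk'
  obtain ⟨z', hz'⟩ := hx'
  obtain ⟨z, hz⟩ := hz
  -- the conjunction
  let A : ι ⊕ ι' → κ ⊕ κ' → R := fun i => i.elim (fun i j => j.elim (a i) 0)
    (fun i j => j.elim 0 (a' i))
  let C : ι ⊕ ι' → R := fun i => i.elim c c'
  let Γ : ι ⊕ ι' → L × M := fun i => i.elim g g'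
  have hΓ : ∀ i, Γ i ∈ G := by rintro (i | i); exacts [hg i, hg' i]
  have hsol : ∃ w : κ ⊕ κ' → L, ∀ i, (∑ j, A i j • w j) = (Γ i).1 + C i • x := by
    refine ⟨fun j => j.elim z z', ?_⟩
    rintro (i | i)
    · simp [A, C, Γ, hz i]
    · simp [A, C, Γ, hz' i, hkg i]
  have hmem : ppSet M A C ∈ T := ⟨_, _, inferInstance, inferInstance, A, C, Γ, hΓ, hsol, rfl⟩
  have hsub1 : ppSet M A C ⊆ V := by
    rw [hV]
    rintro y ⟨w, hw⟩
    refine ⟨fun j => w (Sum.inl j), fun i => ?_⟩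
    simpa [A, C] using hw (Sum.inl i)
  have hsub2 : V ⊆ ppSet M A C := hVmin.le_of_le hmem hsub1
  obtain ⟨y1, w1, hw1⟩ := key _ _ A C Γ hΓ hsol
  have hd : y0 - y1 ∈ V := by
    rw [hV]
    refine ⟨fun j => z0 j - w1 (Sum.inl j), fun i => ?_⟩
    have h1 := hw1 (Sum.inl i)
    simp only [A, C, Γ, Fintype.sum_sum_type, Sum.elim_inl, Sum.elim_inr, Pi.zero_apply, zero_smul,
      Finset.sum_const_zero, add_zero] at h1
    simp only [smul_sub, Finset.sum_sub_distrib, hy0 i, h1]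
    abel
  obtain ⟨w2, hw2⟩ := hsub2 hd
  refine ⟨fun j => w1 (Sum.inr j) + w2 (Sum.inr j), fun i => ?_⟩
  have h1 := hw1 (Sum.inr i)
  have h2 := hw2 (Sum.inr i)
  simp only [A, C, Γ, Fintype.sum_sum_type, Sum.elim_inl, Sum.elim_inr, Pi.zero_apply, zero_smul,
      Finset.sum_const_zero, zero_add] at h1 h2
  simp only [smul_add, Finset.sum_add_distrib, h1, h2, hkg i, smul_sub, Prod.snd_add, Prod.smul_snd]
  abel

theorem GoodRel.exists_linearMap {R : Type u} [CommRing R] {L M : Type u} [AddCommGroup L]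
    [Module R L] [AddCommGroup M] [Module R M] {G : Submodule R (L × M)} (hG : GoodRel R G)
    (hfin : (ppSets R M).Finite) : ∃ h : L →ₗ[R] M, ∀ p ∈ G, h p.1 = p.2 := by
  obtain ⟨H, hGH, hmax⟩ := zorn_le_nonempty₀ {H : Submodule R (L × M) | GoodRel R H} (by
    intro c hc hchain N hN
    refine ⟨sSup c, ?_, fun z hz => le_sSup hz⟩
    intro ι κ _ _ a k hk hx
    have hdir : DirectedOn (· ≤ ·) c := hchain.directedOn
    have hk' : ∀ i, ∃ P : c, k i ∈ P.1 := fun i => by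
      obtain ⟨P, hP, h⟩ := (Submodule.mem_sSup_of_directed ⟨N, hN⟩ hdir).1 (hk i)
      exact ⟨⟨P, hP⟩, h⟩
    choose P hP using hk'
    have : Nonempty c := ⟨⟨N, hN⟩⟩
    obtain ⟨Q, hQ⟩ := hdir.directed_val.finset_le (Finset.univ.image P)
    refine hc Q.2 ι κ a k (fun i => hQ (P i) (by simp) (hP i)) hx) G hG
  have hH : GoodRel R H := hmax.prop
  have huniq : ∀ y : M, ((0 : L), y) ∈ H → y = 0 := by
    intro y hy
    obtain ⟨_, h⟩ := hH Unit Empty (fun _ j => j.elim) (fun _ => (0, y)) (fun _ => hy)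
      ⟨fun j => j.elim, fun _ => by simp⟩
    simpa using (h ()).symm
  have htot : ∀ x : L, ∃ y : M, (x, y) ∈ H := by
    intro x
    obtain ⟨y, hy⟩ := hH.step hfin x
    refine ⟨y, hmax.le_of_ge hy le_sup_left ?_⟩
    exact Submodule.mem_sup_right (Submodule.mem_span_singleton_self _)
  let π : H →ₗ[R] L := (LinearMap.fst R L M).comp H.subtype
  have hπ : Function.Bijective π := by
    constructor
    · rw [← LinearMap.ker_eq_bot, LinearMap.ker_eq_bot']
      rintro ⟨⟨x, y⟩, hxy⟩ h
      have hx : x = 0 := h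
      subst hx
      have := huniq y hxy
      subst this
      rfl
    · intro x
      obtain ⟨y, hy⟩ := htot x
      exact ⟨⟨(x, y), hy⟩, rfl⟩
  let e := LinearEquiv.ofBijective π hπ
  refine ⟨((LinearMap.snd R L M).comp H.subtype).comp e.symm.toLinearMap, fun p hp => ?_⟩
  have : e.symm p.1 = ⟨p, hGH hp⟩ := by
    rw [LinearEquiv.symm_apply_eq]; rfl
  simp [this]

end PartA

section PartB

theorem char_factor {A B : Type*} [AddCommGroup A] [AddCommGroup B] (β : A →+ B)
    (l : A →+ AddCircle (1 : ℚ)) (h : ∀ a, β a = 0 → l a = 0) :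
    ∃ μ : B →+ AddCircle (1 : ℚ), ∀ a, μ (β a) = l a := by
  have hker : β.ker ≤ l.ker := fun a ha => h a ha
  let i : (A ⧸ β.ker) →+ B := QuotientAddGroup.kerLift β
  let l' : (A ⧸ β.ker) →+ AddCircle (1 : ℚ) := QuotientAddGroup.lift β.ker l hker
  obtain ⟨μ, hμ⟩ := CharacterModule.dual_surjective_of_injective i.toIntLinearMap
    (QuotientAddGroup.kerLift_injective β) l'
  refine ⟨μ, fun a => ?_⟩
  have := DFunLike.congr_fun hμ (a : A ⧸ β.ker)
  exact this

theorem char_separate {A : Type*} [AddCommGroup A] (a : A) (h : ∀ c : CharacterModule A, c a = 0) :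
    a = 0 := by
  by_contra hne
  obtain ⟨c, hc⟩ := CharacterModule.exists_character_apply_ne_zero_of_ne_zero hne
  exact hc (h c)

/-- The linear map `L → Hom(R, ℚ/ℤ)` induced by a character of `L`. -/
def coind {R : Type u} [CommRing R] {L : Type u} [AddCommGroup L] [Module R L]
    (c : L →+ AddCircle (1 : ℚ)) : L →ₗ[R] CharacterModule R where
  toFun l := c.comp (LinearMap.toSpanSingleton R L l).toAddMonoidHom
  map_add' x y := by
    refine CharacterModule.ext _ fun s => ?_
    change c (s • (x + y)) = c (s • x) + c (s • y)
    rw [smul_add, map_add]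
  map_smul' r x := by
    refine CharacterModule.ext _ fun s => ?_
    change c (s • (r • x)) = c ((r • s) • x)
    rw [smul_smul, smul_eq_mul, mul_comm]

theorem coind_apply {R : Type u} [CommRing R] {L : Type u} [AddCommGroup L] [Module R L]
    (c : L →+ AddCircle (1 : ℚ)) (l : L) (s : R) : (coind (R := R) c l) s = c (s • l) := rfl

/-- The module `Hom(R / rR, ℚ/ℤ)`. -/
abbrev DualMod (R : Type u) [CommRing R] (r : R) : Type u :=
  Submodule.torsionBy R (CharacterModule R) r

theorem dualMod_apply {R : Type u} [CommRing R] {r : R} (e : DualMod R r) (s : R) :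
    e.1 (r * s) = 0 := by
  have h : r • e.1 = 0 := (Submodule.mem_torsionBy_iff r e.1).1 e.2
  exact DFunLike.congr_fun h s

theorem mem_dualMod {R : Type u} [CommRing R] {r : R} {c : CharacterModule R}
    (h : ∀ s, c (r * s) = 0) : c ∈ Submodule.torsionBy R (CharacterModule R) r := by
  rw [Submodule.mem_torsionBy_iff]
  exact CharacterModule.ext _ fun s => h s

theorem char_map_smul_one {R : Type u} [CommRing R] {K : Type u} [AddCommGroup K] [Module R K]
    {r : R} (g : K →ₗ[R] DualMod R r) (s : R) (k : K) : (g (s • k)).1 1 = (g k).1 s := by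
  rw [map_smul]
  change (g k).1 (s • 1) = _
  simp

theorem dualMod_rdInjective {R : Type u} [CommRing R] (r : R) : RDInjectiveC R (DualMod R r) := by
  intro K L _ _ _ _ f hf hRD g
  let S : Submodule R L := LinearMap.range (LinearMap.lsmul R L r)
  let β : K →+ L ⧸ S := (S.mkQ.comp f).toAddMonoidHom
  let l : K →+ AddCircle (1 : ℚ) :=
    { toFun := fun k => (g k).1 1
      map_zero' := by rw [map_zero]; rfl
      map_add' := fun x y => by rw [map_add]; rfl }
  obtain ⟨μ, hμ⟩ := char_factor β l (by
    intro k hk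
    have hk' : f k ∈ S := (Submodule.Quotient.mk_eq_zero S).1 hk
    obtain ⟨y, hy⟩ := hk'
    obtain ⟨k', rfl⟩ := hRD r k y hy.symm
    change (g (r • k')).1 1 = 0
    rw [char_map_smul_one]
    simpa using dualMod_apply (g k') 1)
  let μ' : L →+ AddCircle (1 : ℚ) := μ.comp S.mkQ.toAddMonoidHom
  refine ⟨(coind (R := R) μ').codRestrict _ (fun x => mem_dualMod fun s => ?_), ?_⟩
  · rw [coind_apply]
    change μ (S.mkQ ((r * s) • x)) = 0
    have : S.mkQ ((r * s) • x) = 0 := by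
      rw [Submodule.mkQ_apply, Submodule.Quotient.mk_eq_zero]
      exact ⟨s • x, by rw [mul_smul]; rfl⟩
    rw [this, map_zero]
  · refine LinearMap.ext fun k => Subtype.ext ?_
    refine CharacterModule.ext _ fun s => ?_
    change μ (S.mkQ (s • f k)) = (g k).1 s
    rw [← map_smul f, ← char_map_smul_one]
    exact hμ (s • k)

theorem pi_rdInjective {R : Type u} [CommRing R] {Ω : Type u} (E : Ω → Type u)
    [∀ ω, AddCommGroup (E ω)] [∀ ω, Module R (E ω)] (hE : ∀ ω, RDInjectiveC R (E ω)) :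
    RDInjectiveC R (∀ ω, E ω) := by
  intro K L _ _ _ _ f hf hRD g
  have h : ∀ ω, ∃ h : L →ₗ[R] E ω, h.comp f = (LinearMap.proj ω).comp g := fun ω =>
    hE ω K L f hf hRD ((LinearMap.proj ω).comp g)
  choose h hh using h
  refine ⟨LinearMap.pi h, ?_⟩
  ext k ω
  exact LinearMap.congr_fun (hh ω) k

theorem char_sum_apply {R : Type u} [CommRing R] {κ : Type} [Fintype κ]
    (y : κ → CharacterModule R) (s : R) : (∑ j, y j) s = ∑ j, (y j) s :=
  map_sum (AddMonoidHom.eval s : (R →+ AddCircle (1 : ℚ)) →+ AddCircle (1 : ℚ)) y Finset.univ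

end PartB

section PartC

/-- The dual of a positive primitive formula evaluated at `R / I`. -/
def dualPP {R : Type u} [CommRing R] {ι κ : Type} [Fintype ι]
    (a : ι → κ → R) (c : ι → R) (I : Ideal R) : Set R :=
  {s | ∃ t : ι → R, s - ∑ i, c i * t i ∈ I ∧ ∀ j, ∑ i, a i j * t i ∈ I}

theorem ppSet_dualMod {R : Type u} [CommRing R] {ι κ : Type} [Fintype ι] [Fintype κ]
    (a : ι → κ → R) (c : ι → R) (r : R) (y : DualMod R r) :
    y ∈ ppSet (DualMod R r) a c ↔ ∀ s ∈ dualPP a c (Ideal.span {r}), y.1 s = 0 := by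
  classical
  have hI : ∀ (e : DualMod R r) (s : R), s ∈ Ideal.span {r} → e.1 s = 0 := by
    intro e s hs
    obtain ⟨t, rfl⟩ := Ideal.mem_span_singleton'.1 hs
    rw [mul_comm]; exact dualMod_apply e t
  constructor
  · rintro ⟨z, hz⟩ s ⟨t, hst, ht⟩
    have h1 : y.1 s = y.1 (∑ i, c i * t i) := by
      have := hI y _ hst
      rwa [map_sub, sub_eq_zero] at this
    have h2 : ∀ i, y.1 (c i * t i) = ∑ j, (z j).1 (a i j * t i) := by
      intro i
      have h3 := congrArg (fun e : DualMod R r => e.1 (t i)) (hz i)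
      simp only [Submodule.coe_sum] at h3
      rw [char_sum_apply] at h3
      exact h3.symm
    rw [h1, map_sum]
    simp only [h2]
    rw [Finset.sum_comm]
    refine Finset.sum_eq_zero fun j _ => ?_
    rw [← map_sum]
    exact hI _ _ (ht j)
  · intro hy
    let I : Ideal R := Ideal.span {r}
    let β : (ι → R) →+ (κ → R ⧸ I) :=
      { toFun := fun t j => Ideal.Quotient.mk I (∑ i, a i j * t i)
        map_zero' := by ext; simp
        map_add' := fun t t' => by ext; simp [mul_add, Finset.sum_add_distrib] }
    let l : (ι → R) →+ AddCircle (1 : ℚ) :=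
      { toFun := fun t => y.1 (∑ i, c i * t i)
        map_zero' := by simp
        map_add' := fun t t' => by
          simp only [Pi.add_apply, mul_add, Finset.sum_add_distrib]; exact map_add y.1 _ _ }
    obtain ⟨μ, hμ⟩ := char_factor β l (by
      intro t ht
      refine hy _ ⟨t, by simp, fun j => ?_⟩
      exact Ideal.Quotient.eq_zero_iff_mem.1 (congrFun ht j))
    let z : κ → CharacterModule R := fun j =>
      μ.comp ((AddMonoidHom.single (fun _ : κ => R ⧸ I) j).comp (Ideal.Quotient.mk I).toAddMonoidHom)
    have hzapp : ∀ j s, z j s = μ (Pi.single j (Ideal.Quotient.mk I s)) := fun j s => rfl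
    refine ⟨fun j => ⟨z j, mem_dualMod fun s => ?_⟩, fun i => ?_⟩
    · rw [hzapp]
      have : Ideal.Quotient.mk I (r * s) = 0 := Ideal.Quotient.eq_zero_iff_mem.2
        (Ideal.mul_mem_right _ _ (Ideal.mem_span_singleton_self r))
      rw [this, Pi.single_zero, map_zero]
    · apply Subtype.ext
      refine CharacterModule.ext _ fun s => ?_
      simp only [Submodule.coe_sum]
      rw [char_sum_apply]
      change ∑ j, z j (a i j * s) = y.1 (c i * s)
      simp only [hzapp]
      rw [← map_sum]
      have h1 := hμ (Pi.single i s)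
      have h2 : β (Pi.single i s) = ∑ j, Pi.single j (Ideal.Quotient.mk I (a i j * s)) := by
        ext j
        change Ideal.Quotient.mk I (∑ i', a i' j * (Pi.single i s : ι → R) i') = _
        rw [Finset.sum_apply]
        simp [Pi.single_apply]
      have h3 : l (Pi.single i s) = y.1 (c i * s) := by
        change y.1 (∑ i', c i' * (Pi.single i s : ι → R) i') = _
        simp [Pi.single_apply]
      rw [← h2, h1, h3]

theorem ppSets_pi_finite {R : Type u} [CommRing R] [Finite (Ideal R)] {Ω : Type u} (r : Ω → R) :
    (ppSets R (∀ ω, DualMod R (r ω))).Finite := by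
  let F : (Ideal R → Ideal R) → Set (∀ ω, DualMod R (r ω)) := fun T =>
    {e | ∀ ω, ∀ s ∈ T (Ideal.span {r ω}), (e ω).1 s = 0}
  refine (Set.finite_range F).subset ?_
  rintro V ⟨ι, κ, _, _, a, c, rfl⟩
  let T : Ideal R → Ideal R := fun I =>
    { carrier := dualPP a c I
      zero_mem' := ⟨0, by simp, by simp⟩
      add_mem' := by
        rintro s s' ⟨t, h1, h2⟩ ⟨t', h1', h2'⟩
        refine ⟨t + t', ?_, fun j => ?_⟩
        · convert I.add_mem h1 h1' using 1
          simp only [Pi.add_apply, mul_add, Finset.sum_add_distrib]; ring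
        · convert I.add_mem (h2 j) (h2' j) using 1
          simp only [Pi.add_apply, mul_add, Finset.sum_add_distrib]
      smul_mem' := by
        rintro x s ⟨t, h1, h2⟩
        refine ⟨x • t, ?_, fun j => ?_⟩
        · convert I.mul_mem_left x h1 using 1
          simp only [Pi.smul_apply, smul_eq_mul, mul_sub, Finset.mul_sum]
          congr 1
          exact Finset.sum_congr rfl fun i _ => by ring
        · convert I.mul_mem_left x (h2 j) using 1
          simp only [Pi.smul_apply, smul_eq_mul, Finset.mul_sum]
          exact Finset.sum_congr rfl fun i _ => by ring }
  refine ⟨T, ?_⟩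
  ext e
  have h1 : e ∈ ppSet (∀ ω, DualMod R (r ω)) a c ↔ ∀ ω, e ω ∈ ppSet (DualMod R (r ω)) a c := by
    constructor
    · rintro ⟨z, hz⟩ ω
      refine ⟨fun j => z j ω, fun i => ?_⟩
      simpa [Finset.sum_apply] using congrFun (hz i) ω
    · intro h
      choose z hz using h
      refine ⟨fun j ω => z ω j, fun i => ?_⟩
      ext1 ω
      simpa [Finset.sum_apply] using hz ω i
  rw [h1]
  simp only [ppSet_dualMod]
  exact Iff.rfl

theorem rdCoflat_rdInjective_of_finite {R : Type u} [CommRing R] [Finite (Ideal R)]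
    {M : Type u} [AddCommGroup M] [Module R M] (hM : RDCoflatC R M) : RDInjectiveC R M := by
  -- embed `M` into a product of `DualMod`s
  let S : R → Submodule R M := fun r => LinearMap.range (LinearMap.lsmul R M r)
  let Ω : Type u := Σ r : R, CharacterModule (M ⧸ S r)
  let E : Type u := ∀ ω : Ω, DualMod R ω.1
  let χ : Ω → (M →+ AddCircle (1 : ℚ)) := fun ω =>
    AddMonoidHom.comp (show (M ⧸ S ω.1) →+ AddCircle (1 : ℚ) from ω.2) (S ω.1).mkQ.toAddMonoidHom
  have hχ : ∀ (ω : Ω) (m : M), χ ω (ω.1 • m) = 0 := by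
    intro ω m
    change ω.2 ((S ω.1).mkQ (ω.1 • m)) = 0
    have : (S ω.1).mkQ (ω.1 • m) = 0 := by
      rw [Submodule.mkQ_apply, Submodule.Quotient.mk_eq_zero]
      exact ⟨m, rfl⟩
    rw [this, map_zero]
  let i : M →ₗ[R] E := LinearMap.pi fun ω =>
    (coind (R := R) (χ ω)).codRestrict _ (fun x => mem_dualMod fun s => by
      rw [coind_apply, mul_smul]; exact hχ ω _)
  have hi : ∀ m (ω : Ω), (i m ω).1 1 = χ ω m := by
    intro m ω
    change χ ω ((1 : R) • m) = _
    rw [one_smul]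
  have hmem : ∀ r m, (∀ c : CharacterModule (M ⧸ S r), (i m ⟨r, c⟩).1 1 = 0) →
      ∃ m', m = r • m' := by
    intro r m h
    have : (S r).mkQ m = 0 := by
      refine char_separate _ fun c => ?_
      have := h c
      rw [hi] at this
      exact this
    rw [Submodule.mkQ_apply, Submodule.Quotient.mk_eq_zero] at this
    obtain ⟨m', hm'⟩ := this
    exact ⟨m', hm'.symm⟩
  have hinj : Function.Injective i := by
    rw [← LinearMap.ker_eq_bot, LinearMap.ker_eq_bot']
    intro m hm
    obtain ⟨m', hm'⟩ := hmem 0 m (fun c => by rw [hm]; rfl)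
    simpa using hm'
  have hRD : ∀ (r : R) (x : M) (y : E), i x = r • y → ∃ x' : M, x = r • x' := by
    intro r x y hxy
    refine hmem r x fun c => ?_
    rw [hxy]
    change (y ⟨r, c⟩).1 (r • 1) = 0
    exact dualMod_apply (y ⟨r, c⟩) 1
  have hpure : IsPureC R i := hM E i hinj hRD
  have hE : RDInjectiveC R E := pi_rdInjective _ fun ω => dualMod_rdInjective ω.1
  have hfin : (ppSets R M).Finite := by
    refine ((ppSets_pi_finite (R := R) (fun ω : Ω => ω.1)).image (fun V => i ⁻¹' V)).subset ?_
    rintro V ⟨ι, κ, _, _, a, c, rfl⟩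
    refine ⟨ppSet E a c, ⟨ι, κ, inferInstance, inferInstance, a, c, rfl⟩, ?_⟩
    ext y
    constructor
    · rintro ⟨z, hz⟩
      exact hpure.general a (fun i => c i • y) ⟨z, fun j => by rw [hz j, map_smul]⟩
    · rintro ⟨z, hz⟩
      exact ⟨fun j => i (z j), fun j => by
        simp only [← map_smul, ← map_sum, hz j]⟩
  -- the extension
  intro K L _ _ _ _ f hf hfRD g
  obtain ⟨h, hh⟩ := hE K L f hf hfRD (i.comp g)
  let G : Submodule R (L × M) := LinearMap.range (f.prod g)
  have hG : GoodRel R G := by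
    intro ι κ _ _ a k hk ⟨x, hx⟩
    refine hpure.general a (fun i => (k i).2) ⟨fun j => h (x j), fun j => ?_⟩
    obtain ⟨w, hw⟩ := hk j
    simp only [← map_smul, ← map_sum, hx j, ← hw]
    exact LinearMap.congr_fun hh w
  obtain ⟨H, hH⟩ := hG.exists_linearMap hfin
  exact ⟨H, LinearMap.ext fun k => hH (f k, g k) ⟨k, rfl⟩⟩

theorem finite_ideal_of_chain (A : Type u) [CommRing A] [IsArtinianRing A]
    (h : ∀ J K : Ideal A, J ≤ K ∨ K ≤ J) : Finite (Ideal A) := by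
  classical
  let _ : LinearOrder (Ideal A) :=
    { (inferInstance : PartialOrder (Ideal A)) with
      le_total := h
      min := fun a b => if a ≤ b then a else b
      max := fun a b => if a ≤ b then b else a
      min_def := fun a b => by congr
      max_def := fun a b => by congr
      toDecidableLE := Classical.decRel _
      toDecidableEq := Classical.decEq _
      toDecidableLT := Classical.decRel _ }
  have h1 : WellFoundedLT (Ideal A) := inferInstanceAs (IsArtinian A A)
  have h2 : IsNoetherian A A := inferInstance
  have h3 : WellFoundedGT (Ideal A) := isNoetherian_iff'.1 h2
  exact Finite.of_wellFoundedLT_wellFoundedGT (Ideal A)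

theorem finite_ideal_of_product {R : Type u} [CommRing R] (n : ℕ) (I : Fin n → Ideal R)
    (h : ∀ i, (IsArtinianRing (R ⧸ I i) ∧
              ∀ J K : Ideal (R ⧸ I i), J ≤ K ∨ K ≤ J) ∨ Finite (R ⧸ I i))
    (e : R ≃+* ∀ i, R ⧸ I i) : Finite (Ideal R) := by
  have h1 : ∀ i, Finite (Ideal (R ⧸ I i)) := by
    intro i
    rcases h i with ⟨h1, h2⟩ | h1
    · exact finite_ideal_of_chain _ h2
    · exact Finite.of_injective (fun J : Ideal (R ⧸ I i) => (J : Set (R ⧸ I i)))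
        SetLike.coe_injective
  have h2 : Finite (Ideal (∀ i, R ⧸ I i)) := Finite.of_equiv _ (Ideal.piOrderIso).symm.toEquiv
  exact Finite.of_injective (Ideal.comap e.symm)
    (Ideal.comap_injective_of_surjective _ e.symm.surjective)

end PartC

section PartD

theorem pi_nat_rdInjective {R : Type u} [CommRing R] (E : ℕ → Type u)
    [∀ n, AddCommGroup (E n)] [∀ n, Module R (E n)] (hE : ∀ n, RDInjectiveC R (E n)) :
    RDInjectiveC R (∀ n, E n) := by
  intro K L _ _ _ _ f hf hRD g
  have h : ∀ n, ∃ h : L →ₗ[R] E n, h.comp f = (LinearMap.proj n).comp g := fun n =>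
    hE n K L f hf hRD ((LinearMap.proj n).comp g)
  choose h hh using h
  refine ⟨LinearMap.pi h, ?_⟩
  ext k n
  exact LinearMap.congr_fun (hh n) k

/-- Truncation of a sequence. -/
def truncMap (R : Type u) [CommRing R] (E : ℕ → Type u)
    [∀ n, AddCommGroup (E n)] [∀ n, Module R (E n)] (B : ℕ) : (∀ n, E n) →ₗ[R] (∀ n, E n) :=
  LinearMap.pi fun n => if n < B then LinearMap.proj n else 0

theorem truncMap_lt {R : Type u} [CommRing R] {E : ℕ → Type u}
    [∀ n, AddCommGroup (E n)] [∀ n, Module R (E n)] {B n : ℕ} (h : n < B) (x : ∀ n, E n) :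
    truncMap R E B x n = x n := by
  simp [truncMap, h]

theorem truncMap_ge {R : Type u} [CommRing R] {E : ℕ → Type u}
    [∀ n, AddCommGroup (E n)] [∀ n, Module R (E n)] {B n : ℕ} (h : B ≤ n) (x : ∀ n, E n) :
    truncMap R E B x n = 0 := by
  simp [truncMap, not_lt.2 h]

/-- The submodule of sequences with finite support. -/
def finSupp (R : Type u) [CommRing R] (E : ℕ → Type u)
    [∀ n, AddCommGroup (E n)] [∀ n, Module R (E n)] : Submodule R (∀ n, E n) where
  carrier := {x | ∃ N, ∀ n, N ≤ n → x n = 0}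
  zero_mem' := ⟨0, fun _ _ => rfl⟩
  add_mem' := by
    rintro x y ⟨N, hN⟩ ⟨N', hN'⟩
    refine ⟨max N N', fun n hn => ?_⟩
    rw [Pi.add_apply, hN n (le_trans (le_max_left _ _) hn),
      hN' n (le_trans (le_max_right _ _) hn), add_zero]
  smul_mem' := by
    rintro r x ⟨N, hN⟩
    exact ⟨N, fun n hn => by rw [Pi.smul_apply, hN n hn, smul_zero]⟩

theorem finSupp_pure {R : Type u} [CommRing R] (E : ℕ → Type u)
    [∀ n, AddCommGroup (E n)] [∀ n, Module R (E n)] : IsPureC R (finSupp R E).subtype := by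
  intro m n a k ⟨x, hx⟩
  have hk : ∀ i, ∃ N, ∀ n, N ≤ n → (k i).1 n = 0 := fun i => (k i).2
  choose N hN using hk
  let B := Finset.univ.sup N
  have hB : ∀ i, truncMap R E B (k i).1 = (k i).1 := by
    intro i
    ext l
    rcases lt_or_ge l B with h | h
    · exact truncMap_lt h _
    · rw [truncMap_ge h, hN i l (le_trans (Finset.le_sup (Finset.mem_univ i)) h)]
  refine ⟨fun j => ⟨truncMap R E B (x j), B, fun l hl => truncMap_ge hl _⟩, fun i => ?_⟩
  apply Subtype.ext
  rw [← hB i]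
  have := hx i
  change _ = (k i).1 at this
  rw [← this]
  simp [map_sum]

theorem exists_retract_s12 {R : Type u} [CommRing R]
    (H : ∀ (M : Type u) [AddCommGroup M] [Module R M], RDCoflatC R M → RDInjectiveC R M)
    (E : ℕ → Type u) [∀ n, AddCommGroup (E n)] [∀ n, Module R (E n)]
    (hE : ∀ n, RDInjectiveC R (E n)) (x : ∀ n, E n) (N₀ : ℕ) :
    ∃ n, N₀ ≤ n ∧ ∃ φ : (∀ n, E n) →ₗ[R] E n, φ (x - truncMap R E (n + 1) x) = - x n := by
  have hco : RDCoflatC R (finSupp R E) := by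
    intro P _ _ f hf hRD
    obtain ⟨h, hh⟩ := pi_nat_rdInjective E hE (finSupp R E) P f hf hRD (finSupp R E).subtype
    intro m n a k ⟨y, hy⟩
    refine finSupp_pure E m n a k ⟨fun j => h (y j), fun i => ?_⟩
    simp only [← map_smul, ← map_sum, hy i]
    exact LinearMap.congr_fun hh (k i)
  obtain ⟨ρ, hρ⟩ := H _ hco (finSupp R E) (∀ n, E n) (finSupp R E).subtype
    (Submodule.subtype_injective _) (by
      intro r k y hky
      obtain ⟨z, hz⟩ := finSupp_pure E 1 1 (fun _ _ => r) (fun _ => k)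
        ⟨fun _ => y, fun _ => by simp [← hky]⟩
      exact ⟨z 0, by simpa using (hz 0).symm⟩) LinearMap.id
  obtain ⟨N, hN⟩ := (ρ x).2
  let n := max N N₀
  refine ⟨n, le_max_right _ _, (LinearMap.proj n).comp ((finSupp R E).subtype.comp ρ), ?_⟩
  have h1 : ρ (truncMap R E (n + 1) x) = ⟨truncMap R E (n + 1) x, n + 1,
      fun l hl => truncMap_ge hl _⟩ :=
    LinearMap.congr_fun hρ ⟨truncMap R E (n + 1) x, n + 1, fun l hl => truncMap_ge hl _⟩
  rw [map_sub]
  change (ρ x).1 n - (ρ (truncMap R E (n + 1) x)).1 n = - x n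
  rw [h1, hN n (le_max_left _ _)]
  change 0 - truncMap R E (n + 1) x n = - x n
  rw [truncMap_lt (Nat.lt_succ_self n), zero_sub]

theorem exists_colon {R : Type u} [CommRing R]
    (H : ∀ (M : Type u) [AddCommGroup M] [Module R M], RDCoflatC R M → RDInjectiveC R M)
    (r : ℕ → R) : ∃ n, ∀ m : Ideal R, m.IsMaximal →
      ∃ i < n, ∃ t, t ∉ m ∧ t * r i ∈ Ideal.span {r n} := by
  by_contra hcon
  push Not at hcon
  have hx : ∀ n, ∃ x : DualMod R (r n), (1 ≤ n → x ≠ 0) ∧ ∀ i < n, ∃ y, x = r i • y := by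
    intro n
    rcases Nat.eq_zero_or_pos n with h0 | hn
    · exact ⟨0, fun h => by omega, fun i hi => by omega⟩
    obtain ⟨m, hm, hmc⟩ := hcon n
    have hmc' : ∀ i < n, ∀ t, t * r i ∈ Ideal.span {r n} → t ∈ m := by
      intro i hi t ht
      by_contra htm
      exact hmc i hi t htm ht
    have hrn : r n ∈ m := hmc' 0 hn (r n)
      (Ideal.mul_mem_right _ _ (Ideal.mem_span_singleton_self _))
    have h1 : (Ideal.Quotient.mk m 1) ≠ 0 := by
      rw [Ne, Ideal.Quotient.eq_zero_iff_mem]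
      exact (Ideal.ne_top_iff_one m).1 hm.ne_top
    obtain ⟨c, hc⟩ := CharacterModule.exists_character_apply_ne_zero_of_ne_zero h1
    let x : R →+ AddCircle (1 : ℚ) :=
      AddMonoidHom.comp (show (R ⧸ m) →+ AddCircle (1 : ℚ) from c)
        (Ideal.Quotient.mk m).toAddMonoidHom
    have hxm : ∀ s ∈ m, x s = 0 := by
      intro s hs
      change c (Ideal.Quotient.mk m s) = 0
      rw [Ideal.Quotient.eq_zero_iff_mem.2 hs, map_zero]
    refine ⟨⟨x, mem_dualMod fun s => hxm _ (Ideal.mul_mem_right _ _ hrn)⟩, fun _ h => ?_,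
      fun i hi => ?_⟩
    · have h2 : (x : CharacterModule R) = 0 := congrArg Subtype.val h
      exact hc (DFunLike.congr_fun h2 (1 : R))
    · let I : Ideal R := Ideal.span {r n}
      let β : R →+ R ⧸ I :=
        (Ideal.Quotient.mk I).toAddMonoidHom.comp (AddMonoidHom.mulLeft (r i))
      obtain ⟨μ, hμ⟩ := char_factor β x (by
        intro t ht
        refine hxm t (hmc' i hi t ?_)
        rw [mul_comm]
        exact Ideal.Quotient.eq_zero_iff_mem.1 ht)
      let y : CharacterModule R := AddMonoidHom.comp μ (Ideal.Quotient.mk I).toAddMonoidHom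
      refine ⟨⟨y, mem_dualMod fun s => ?_⟩, ?_⟩
      · change μ (Ideal.Quotient.mk I (r n * s)) = 0
        rw [Ideal.Quotient.eq_zero_iff_mem.2
          (Ideal.mul_mem_right _ _ (Ideal.mem_span_singleton_self _)), map_zero]
      · apply Subtype.ext
        exact CharacterModule.ext _ fun s => (hμ s).symm
  choose x hx0 hxy using hx
  obtain ⟨n, hn, φ, hφ⟩ := exists_retract_s12 H (fun n => DualMod R (r n))
    (fun n => dualMod_rdInjective (r n)) x 1
  have hdiv : ∃ y : ∀ k, DualMod R (r k),
      x - truncMap R (fun n => DualMod R (r n)) (n + 1) x = r n • y := by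
    have : ∀ k, ∃ y : DualMod R (r k),
        (x - truncMap R (fun n => DualMod R (r n)) (n + 1) x) k = r n • y := by
      intro k
      rcases lt_or_ge k (n + 1) with h | h
      · exact ⟨0, by rw [Pi.sub_apply, truncMap_lt h, sub_self, smul_zero]⟩
      · obtain ⟨y, hy⟩ := hxy k n (by omega)
        exact ⟨y, by rw [Pi.sub_apply, truncMap_ge h, sub_zero]; exact hy⟩
    choose y hy using this
    exact ⟨y, funext hy⟩
  obtain ⟨y, hy⟩ := hdiv
  rw [hy, map_smul, Submodule.smul_torsionBy] at hφ
  exact hx0 n hn (neg_eq_zero.1 hφ.symm)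

theorem exists_mem_span {R : Type u} [CommRing R]
    (H : ∀ (M : Type u) [AddCommGroup M] [Module R M], RDCoflatC R M → RDInjectiveC R M)
    (a : ℕ → R) : ∃ n, a n ∈ Ideal.span (a '' {i | i < n}) := by
  by_contra hcon
  push Not at hcon
  have hx : ∀ n, ∃ x : DualMod R (0 : R), x.1 (a n) ≠ 0 ∧ ∀ i < n, a i • x = 0 := by
    intro n
    let I := Ideal.span (a '' {i | i < n})
    have h1 : Ideal.Quotient.mk I (a n) ≠ 0 := by
      rw [Ne, Ideal.Quotient.eq_zero_iff_mem]
      exact hcon n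
    obtain ⟨c, hc⟩ := CharacterModule.exists_character_apply_ne_zero_of_ne_zero h1
    let x : R →+ AddCircle (1 : ℚ) :=
      AddMonoidHom.comp (show (R ⧸ I) →+ AddCircle (1 : ℚ) from c)
        (Ideal.Quotient.mk I).toAddMonoidHom
    refine ⟨⟨x, mem_dualMod fun s => by rw [zero_mul]; exact map_zero x⟩, hc, fun i hi => ?_⟩
    apply Subtype.ext
    refine CharacterModule.ext _ fun s => ?_
    change c (Ideal.Quotient.mk I (a i * s)) = 0
    rw [Ideal.Quotient.eq_zero_iff_mem.2, map_zero]
    exact Ideal.mul_mem_right _ _ (Ideal.subset_span ⟨i, hi, rfl⟩)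
  choose x hx0 hxa using hx
  obtain ⟨n, -, φ, hφ⟩ := exists_retract_s12 H (fun _ => DualMod R (0 : R))
    (fun _ => dualMod_rdInjective 0) x 0
  have h0 : a n • (x - truncMap R (fun _ => DualMod R (0 : R)) (n + 1) x) = 0 := by
    ext1 k
    rw [Pi.smul_apply, Pi.sub_apply]
    rcases lt_or_ge k (n + 1) with h | h
    · rw [truncMap_lt h, sub_self, smul_zero]; rfl
    · rw [truncMap_ge h, sub_zero]
      exact hxa k n (by omega)
  have h1 : a n • x n = 0 := by
    have := congrArg (fun z => a n • z) hφ
    simp only [← map_smul, h0, map_zero, smul_neg] at this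
    exact neg_eq_zero.1 this.symm
  have h2 := congrArg (fun z : DualMod R (0 : R) => z.1 (1 : R)) h1
  apply hx0 n
  change (x n).1 (a n * 1) = 0 at h2
  rwa [mul_one] at h2

theorem noetherian_of_hyp {R : Type u} [CommRing R]
    (H : ∀ (M : Type u) [AddCommGroup M] [Module R M], RDCoflatC R M → RDInjectiveC R M) :
    IsNoetherianRing R := by
  have : WellFounded ((· > ·) : Ideal R → Ideal R → Prop) := by
    rw [RelEmbedding.wellFounded_iff_isEmpty]
    refine ⟨fun f => ?_⟩
    have hlt : ∀ n, f n < f (n + 1) := fun n => f.map_rel_iff.2 (Nat.lt_succ_self n)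
    have hmono : Monotone f := monotone_nat_of_le_succ fun n => (hlt n).le
    have hex : ∀ n, ∃ a ∈ f (n + 1), a ∉ f n := fun n => SetLike.exists_of_lt (hlt n)
    choose a ha ha' using hex
    obtain ⟨n, hn⟩ := exists_mem_span H a
    apply ha' n
    refine (Ideal.span_le.2 ?_) hn
    rintro _ ⟨i, hi, rfl⟩
    exact hmono (show i + 1 ≤ n from hi) (ha i)
  exact isNoetherian_iff'.2 ⟨this⟩

theorem artinian_of_hyp {R : Type u} [CommRing R]
    (H : ∀ (M : Type u) [AddCommGroup M] [Module R M], RDCoflatC R M → RDInjectiveC R M) :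
    IsArtinianRing R := by
  have hN := noetherian_of_hyp H
  rw [isArtinianRing_iff_isNoetherianRing_krullDimLE_zero]
  refine ⟨hN, Ring.KrullDimLE.mk₀ fun P hP => ?_⟩
  obtain ⟨m, hm, hPm⟩ := Ideal.exists_le_maximal P hP.ne_top
  have hmP : m ≤ P := by
    intro x hxm
    by_contra hxP
    obtain ⟨n, hn⟩ := exists_colon H (fun n => x ^ n)
    obtain ⟨i, hi, t, htm, ht⟩ := hn m hm
    obtain ⟨s, hs⟩ := Ideal.mem_span_singleton'.1 ht
    obtain ⟨d, rfl⟩ : ∃ d, n = i + (d + 1) := ⟨n - i - 1, by omega⟩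
    have h1 : x ^ i * (t - s * x ^ (d + 1)) ∈ P := by
      have : x ^ i * (t - s * x ^ (d + 1)) = 0 := by
        rw [mul_sub, sub_eq_zero, mul_comm, ← hs, pow_add]; ring
      rw [this]; exact P.zero_mem
    rcases hP.mem_or_mem h1 with h | h
    · exact hxP (hP.mem_of_pow_mem _ h)
    · apply htm
      have h2 := m.add_mem (hPm h) (m.mul_mem_left (s * x ^ d) hxm)
      have h3 : t - s * x ^ (d + 1) + s * x ^ d * x = t := by ring
      rwa [h3] at h2
  rwa [le_antisymm hPm hmP]

theorem chain_of_infinite {R : Type u} [CommRing R]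
    (H : ∀ (M : Type u) [AddCommGroup M] [Module R M], RDCoflatC R M → RDInjectiveC R M)
    (m : Ideal R) (hm : m.IsMaximal) (hinf : Infinite (R ⧸ m)) (k : ℕ) :
    ∀ J K : Ideal (R ⧸ m ^ k), J ≤ K ∨ K ≤ J := by
  have key : ∀ a b : R, ∃ t, t ∉ m ∧ (t * a ∈ Ideal.span {b} ∨ t * b ∈ Ideal.span {a}) := by
    intro a b
    let v : ℕ ↪ R ⧸ m := Infinite.natEmbedding _
    choose u hu using fun i => Ideal.Quotient.mk_surjective (v i)
    obtain ⟨n, hn⟩ := exists_colon H (fun j => a + u j * b)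
    obtain ⟨i, hi, t, htm, ht⟩ := hn m hm
    obtain ⟨s, hs⟩ := Ideal.mem_span_singleton'.1 ht
    have he : (t - s) * a = (s * u n - t * u i) * b := by linear_combination -hs
    by_cases hts : t - s ∈ m
    · refine ⟨s * u n - t * u i, fun hmem => ?_, Or.inr ?_⟩
      · have h1 : t * (u n - u i) ∈ m := by
          have h2 := m.add_mem hmem (m.mul_mem_right (u n) hts)
          have h3 : s * u n - t * u i + (t - s) * u n = t * (u n - u i) := by ring
          rwa [h3] at h2
        rcases hm.isPrime.mem_or_mem h1 with h | h
        · exact htm h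
        · have h4 := Ideal.Quotient.eq.2 h
          rw [hu, hu] at h4
          have := v.injective h4
          omega
      · rw [← he]; exact Ideal.mul_mem_left _ _ (Ideal.mem_span_singleton_self _)
    · refine ⟨t - s, hts, Or.inl ?_⟩
      rw [he]; exact Ideal.mul_mem_left _ _ (Ideal.mem_span_singleton_self _)
  have hunit : ∀ t, t ∉ m → ∃ w, Ideal.Quotient.mk (m ^ k) (w * t) = 1 := by
    intro t ht
    obtain ⟨y, hy⟩ := hm.exists_inv ht
    obtain ⟨z, hz, hyz⟩ := hy
    have hnil : IsNilpotent (Ideal.Quotient.mk (m ^ k) z) := by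
      refine ⟨k, ?_⟩
      rw [← map_pow]
      exact Ideal.Quotient.eq_zero_iff_mem.2 (Ideal.pow_mem_pow hz k)
    have h1 : Ideal.Quotient.mk (m ^ k) (y * t) = 1 - Ideal.Quotient.mk (m ^ k) z := by
      rw [← map_one (Ideal.Quotient.mk (m ^ k)), ← hyz, map_add]; ring
    obtain ⟨w, hw⟩ := (hnil.isUnit_one_sub).exists_left_inv
    obtain ⟨w', rfl⟩ := Ideal.Quotient.mk_surjective w
    refine ⟨w' * y, ?_⟩
    rw [mul_assoc, map_mul, h1, hw]
  have hmem : ∀ (t a b : R) (J : Ideal (R ⧸ m ^ k)), t ∉ m → t * a ∈ Ideal.span {b} →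
      Ideal.Quotient.mk (m ^ k) b ∈ J → Ideal.Quotient.mk (m ^ k) a ∈ J := by
    intro t a b J ht hta hb
    obtain ⟨w, hw⟩ := hunit t ht
    obtain ⟨s, hs⟩ := Ideal.mem_span_singleton'.1 hta
    have : Ideal.Quotient.mk (m ^ k) a = Ideal.Quotient.mk (m ^ k) (w * s) *
        Ideal.Quotient.mk (m ^ k) b := by
      rw [← map_mul, mul_assoc, hs, ← mul_assoc, map_mul, hw, one_mul]
    rw [this]
    exact J.mul_mem_left _ hb
  intro J K
  by_contra hcon
  push Not at hcon
  obtain ⟨h1, h2⟩ := hcon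
  obtain ⟨a', haJ, haK⟩ := SetLike.not_le_iff_exists.1 h1
  obtain ⟨b', hbK, hbJ⟩ := SetLike.not_le_iff_exists.1 h2
  obtain ⟨a, rfl⟩ := Ideal.Quotient.mk_surjective a'
  obtain ⟨b, rfl⟩ := Ideal.Quotient.mk_surjective b'
  obtain ⟨t, ht, h | h⟩ := key a b
  · exact haK (hmem t a b K ht h hbK)
  · exact hbJ (hmem t b a J ht h haJ)

theorem product_of_hyp {R : Type u} [CommRing R]
    (H : ∀ (M : Type u) [AddCommGroup M] [Module R M], RDCoflatC R M → RDInjectiveC R M) :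
    ∃ (n : ℕ) (I : Fin n → Ideal R),
      (∀ i, (IsArtinianRing (R ⧸ I i) ∧
              ∀ J K : Ideal (R ⧸ I i), J ≤ K ∨ K ≤ J) ∨ Finite (R ⧸ I i)) ∧
      Nonempty (R ≃+* ∀ i, R ⧸ I i) := by
  have hA := artinian_of_hyp H
  have hN := noetherian_of_hyp H
  obtain ⟨k, hk⟩ : IsNilpotent (nilradical R) := IsNoetherianRing.isNilpotent_nilradical R
  let ε := (Finite.equivFin (MaximalSpectrum R)).symm
  refine ⟨_, fun i => (ε i).asIdeal ^ k, fun i => ?_, ⟨?_⟩⟩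
  · have hm : (ε i).asIdeal.IsMaximal := (ε i).isMaximal
    rcases finite_or_infinite (R ⧸ (ε i).asIdeal) with hf | hinf
    · exact Or.inr (Ideal.finite_quotient_pow (IsNoetherian.noetherian _) k)
    · exact Or.inl ⟨inferInstance, chain_of_infinite H _ hm hinf k⟩
  · let e1 : R ≃+* R ⧸ (nilradical R ^ k) :=
      (RingEquiv.quotientBot R).symm.trans (Ideal.quotEquivOfEq hk.symm)
    let e2 := (IsArtinianRing.quotNilradicalPowEquivPi R k).toRingEquiv
    exact (e1.trans e2).trans
      (RingEquiv.piCongrLeft (fun I : MaximalSpectrum R => R ⧸ I.asIdeal ^ k) ε).symm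

end PartD

/-- A commutative ring `R` is a finite product of rings, each of which is an artinian
valuation ring (ideals totally ordered) or a finite ring, if and only if every
RD-coflat `R`-module is RD-injective. -/
theorem finite_product_iff_rdCoflat_rdInjective (R : Type u) [CommRing R] :
    (∃ (n : ℕ) (I : Fin n → Ideal R),
      (∀ i, (IsArtinianRing (R ⧸ I i) ∧
              ∀ J K : Ideal (R ⧸ I i), J ≤ K ∨ K ≤ J) ∨ Finite (R ⧸ I i)) ∧
      Nonempty (R ≃+* ∀ i, R ⧸ I i)) ↔
    (∀ (M : Type u) [AddCommGroup M] [Module R M], RDCoflatC R M → RDInjectiveC R M) := by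
  constructor
  · rintro ⟨n, I, h, ⟨e⟩⟩ M _ _ hM
    have := finite_ideal_of_product n I h e
    exact rdCoflat_rdInjective_of_finite hM
  · intro H
    exact product_of_hyp H
end
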